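/- Let ℓ be a prime and let K be a function field over an algebraically closed field k with char k ≠ ℓ and trdeg(K|k) ≥ 5. Let t_1, t_2 ∈ K be algebraically independent over k with t_2 separable in K. Then for all but finitely many b ∈ k the following holds: for all but finitely many a ∈ k (the exceptional set may depend on b), the element (t_1 + a)/(t_2 + b) is very general in K. -/

import Mathlib

/-! Common definitions: mod-ℓ Milnor K-theory, K^×/(K^×)^ℓ, Ω_K, relative algebraic
closure, transcendence degree predicates, discrete valuations, etc. -/

noncomputable section

open scoped TensorProduct

universe u v

/-- The `n`-fold tensor power (over `ℤ`) of the multiplicative group `Kˣ`,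
written additively. -/
abbrev MilnorPre (n : ℕ) (K : Type*) [Field K] : Type _ :=
  PiTensorProduct ℤ (fun _ : Fin n => Additive Kˣ)

/-- The submodule of Steinberg relations: generated by all `a₁ ⊗ ⋯ ⊗ aₙ`
with `aᵢ + aⱼ = 1` for some `i < j`. -/
def SteinbergRel (n : ℕ) (K : Type*) [Field K] : Submodule ℤ (MilnorPre n K) :=
  Submodule.span ℤ
    {x | ∃ a : Fin n → Kˣ,
      (∃ i j : Fin n, i < j ∧ ((a i : K) + (a j : K) = 1)) ∧
        x = PiTensorProduct.tprod ℤ (fun i => Additive.ofMul (a i))}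

/-- The `n`-th Milnor K-group `K^M_n(K)`: the quotient of the `n`-fold tensor
power of `K^×` by the Steinberg relations. -/
abbrev MilnorK (n : ℕ) (K : Type*) [Field K] : Type _ :=
  MilnorPre n K ⧸ SteinbergRel n K

/-- The mod-`ℓ` Milnor K-group `k^M_n(K) = K^M_n(K)/ℓ`. -/
abbrev MilnorKMod (ℓ n : ℕ) (K : Type*) [Field K] : Type _ :=
  MilnorK n K ⧸ LinearMap.range ((ℓ : ℤ) • (LinearMap.id : MilnorK n K →ₗ[ℤ] MilnorK n K))

/-- The symbol `{a₁, …, aₙ}` in `k^M_n(K)`. -/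
def milnorSymbol (ℓ : ℕ) {n : ℕ} {K : Type*} [Field K] (a : Fin n → Kˣ) :
    MilnorKMod ℓ n K :=
  Submodule.Quotient.mk (Submodule.Quotient.mk
    (PiTensorProduct.tprod ℤ (fun i => Additive.ofMul (a i))))

/-- `k^M_1(K) = K^×/(K^×)^ℓ`, written multiplicatively. -/
abbrev K1 (ℓ : ℕ) (K : Type*) [Field K] : Type _ :=
  Kˣ ⧸ (powMonoidHom ℓ : Kˣ →* Kˣ).range

/-- The projection `K^× → K^×/(K^×)^ℓ`. -/
def K1proj (ℓ : ℕ) (K : Type*) [Field K] : Kˣ →* K1 ℓ K :=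
  QuotientGroup.mk' _

/-- The subgroup of `Kˣ` consisting of the units lying in an intermediate field `L`. -/
def fieldUnits {k K : Type*} [Field k] [Field K] [Algebra k K]
    (L : IntermediateField k K) : Subgroup Kˣ where
  carrier := {x : Kˣ | (x : K) ∈ L}
  one_mem' := by simpa using one_mem L
  mul_mem' := by
    intro a b ha hb
    simpa using mul_mem ha hb
  inv_mem' := by
    intro a ha
    simpa using inv_mem (show (a : K) ∈ L from ha)

/-- `Ω_K(L)`: the image of `L^×` in `K^×/(K^×)^ℓ`. -/
def Omega (ℓ : ℕ) {k K : Type*} [Field k] [Field K] [Algebra k K]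
    (L : IntermediateField k K) : Subgroup (K1 ℓ K) :=
  (fieldUnits L).map (K1proj ℓ K)

/-- A subextension `L` of `K|k` is relatively algebraically closed in `K` if every
element of `K` algebraic over `L` lies in `L`. -/
def RelAlgClosed {k K : Type*} [Field k] [Field K] [Algebra k K]
    (L : IntermediateField k K) : Prop :=
  ∀ x : K, IsAlgebraic L x → x ∈ L

/-- `K` is a function field over `k`: a finitely generated field extension. -/
def IsFunctionField (k K : Type*) [Field k] [Field K] [Algebra k K] : Prop :=
  ∃ s : Finset K, IntermediateField.adjoin k (s : Set K) = ⊤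

/-- `trdeg(K|k) = d`: there is a transcendence basis indexed by `Fin d`. -/
def HasTrdeg (k : Type*) (K : Type*) [Field k] [Field K] [Algebra k K] (d : ℕ) : Prop :=
  ∃ x : Fin d → K, IsTranscendenceBasis k x

/-- `trdeg(K|k) ≥ m`: there are `m` algebraically independent elements. -/
def TrdegGe (k : Type*) (K : Type*) [Field k] [Field K] [Algebra k K] (m : ℕ) : Prop :=
  ∃ x : Fin m → K, AlgebraicIndependent k x

/-- `dim^M_K(S) ≥ d` for a subset `S ⊆ k^M_1(K)`: there are `s₁, …, s_d ∈ S` with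
`{s₁, …, s_d} ≠ 0` in `k^M_d(K)`. -/
def dimMge (ℓ : ℕ) {K : Type*} [Field K] (S : Set (K1 ℓ K)) (d : ℕ) : Prop :=
  ∃ a : Fin d → Kˣ, (∀ i, K1proj ℓ K (a i) ∈ S) ∧ milnorSymbol ℓ a ≠ 0

/-- `dim^M_K(S) = r`. -/
def dimMeq (ℓ : ℕ) {K : Type*} [Field K] (S : Set (K1 ℓ K)) (r : ℕ) : Prop :=
  dimMge ℓ S r ∧ ¬ dimMge ℓ S (r + 1)

/-- `t` is a general element of `K` over `k`: `t ∉ k` and `k(t)` is relatively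
algebraically closed in `K`. -/
def IsGeneralElement (k : Type*) {K : Type*} [Field k] [Field K] [Algebra k K] (t : K) : Prop :=
  t ∉ (⊥ : IntermediateField k K) ∧ RelAlgClosed (IntermediateField.adjoin k {t})

/-- A rational subgroup of `k^M_1(K)`: `Ω_K(k(t))` for a general element `t`. -/
def IsRationalSubgroup (ℓ : ℕ) (k : Type*) {K : Type*} [Field k] [Field K] [Algebra k K]
    (A : Subgroup (K1 ℓ K)) : Prop :=
  ∃ t : K, IsGeneralElement k t ∧ A = Omega ℓ (IntermediateField.adjoin k {t})

/-- `𝔊^r(K|k)`: the subgroups `Ω_K(L)` for `L` relatively algebraically closed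
in `K` of transcendence degree `r` over `k`. -/
def GSet (ℓ : ℕ) (k : Type*) {K : Type*} [Field k] [Field K] [Algebra k K] (r : ℕ) :
    Set (Subgroup (K1 ℓ K)) :=
  {A | ∃ L : IntermediateField k K, RelAlgClosed L ∧ HasTrdeg k L r ∧ A = Omega ℓ L}

/-- `𝔐^1(K)`: subgroups maximal among the subgroups `B` of `k^M_1(K)`
with `dim^M_K(B) = 1`. -/
def M1Set (ℓ : ℕ) (K : Type*) [Field K] : Set (Subgroup (K1 ℓ K)) :=
  {A | dimMeq ℓ (A : Set (K1 ℓ K)) 1 ∧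
    ∀ B : Subgroup (K1 ℓ K), dimMeq ℓ (B : Set (K1 ℓ K)) 1 → A ≤ B → B = A}

/-- Condition (a) and (b) of the maximality characterization of `𝔊^r`:
`B` is generated by rational subgroups and `dim^M_K(B) = r`. -/
def SpannedByRatWithDim (ℓ : ℕ) (k : Type*) {K : Type*} [Field k] [Field K] [Algebra k K]
    (r : ℕ) (B : Subgroup (K1 ℓ K)) : Prop :=
  (∃ S : Set (Subgroup (K1 ℓ K)), (∀ T ∈ S, IsRationalSubgroup ℓ k T) ∧ B = sSup S) ∧
    dimMeq ℓ (B : Set (K1 ℓ K)) r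

/-- A discrete valuation of a field `F`: a surjective homomorphism `F^× → ℤ`
satisfying the ultrametric inequality. -/
structure DiscreteValuation (F : Type*) [Field F] where
  v : Fˣ → ℤ
  map_mul' : ∀ x y : Fˣ, v (x * y) = v x + v y
  surjective' : Function.Surjective v
  min_le' : ∀ x y z : Fˣ, (x : F) + (y : F) = (z : F) → min (v x) (v y) ≤ v z

lemma DiscreteValuation.v_one {F : Type*} [Field F] (w : DiscreteValuation F) : w.v 1 = 0 := by
  have h := w.map_mul' 1 1
  simp only [mul_one] at h
  omega

/-- A discrete valuation of `F` is trivial on the base field `k`. -/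
def DiscreteValuation.TrivialOn (k : Type*) {F : Type*} [Field k] [Field F] [Algebra k F]
    (w : DiscreteValuation F) : Prop :=
  ∀ (c : k) (hc : algebraMap k F c ≠ 0), w.v (Units.mk0 _ hc) = 0

/-- The unit group `U_w ⊆ F^×` of a discrete valuation. -/
def DiscreteValuation.units {F : Type*} [Field F] (w : DiscreteValuation F) : Subgroup Fˣ where
  carrier := {x : Fˣ | w.v x = 0}
  one_mem' := w.v_one
  mul_mem' := by
    intro a b ha hb
    have h := w.map_mul' a b
    simp only [Set.mem_setOf_eq] at ha hb ⊢
    omega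
  inv_mem' := by
    intro a ha
    have h := w.map_mul' a a⁻¹
    rw [mul_inv_cancel] at h
    have h1 := w.v_one
    simp only [Set.mem_setOf_eq] at ha ⊢
    omega

/-- `𝔘_v`: the image of the unit group `U_v` in `K^×/(K^×)^ℓ`. -/
def DiscreteValuation.unitsImage (ℓ : ℕ) {F : Type*} [Field F] (w : DiscreteValuation F) :
    Subgroup (K1 ℓ F) :=
  w.units.map (K1proj ℓ F)

/-- For a discrete valuation `w` of an intermediate field `F` of `K|k`, the image of
the unit group `U_w` in `K^×/(K^×)^ℓ`. -/
def unitsImageIn (ℓ : ℕ) {k K : Type*} [Field k] [Field K] [Algebra k K]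
    (F : IntermediateField k K) (w : DiscreteValuation F) : Subgroup (K1 ℓ K) :=
  (w.units.map (Units.map (algebraMap F K).toMonoidHom)).map (K1proj ℓ K)

/-- The residue field of `v` has transcendence degree `≥ m` over `k`: there are
`v`-units `x₁, …, x_m` whose residues are algebraically independent over `k`,
expressed by saying that every nonzero polynomial over `k` evaluated at the `xᵢ`
is a unit of value `0`. -/
def DiscreteValuation.ResidueTrdegGe (k : Type*) {K : Type*} [Field k] [Field K] [Algebra k K]
    (v : DiscreteValuation K) (m : ℕ) : Prop :=
  ∃ x : Fin m → Kˣ, (∀ i, v.v (x i) = 0) ∧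
    ∀ P : MvPolynomial (Fin m) k, P ≠ 0 →
      ∃ u : Kˣ, (u : K) = MvPolynomial.aeval (fun i => ((x i : K))) P ∧ v.v u = 0

/-- A divisorial-type valuation of `K|k` (where `d = trdeg(K|k)`): a discrete valuation
trivial on `k` whose residue field has transcendence degree exactly `d - 1` over `k`. -/
def IsDivisorialType (k : Type*) {K : Type*} [Field k] [Field K] [Algebra k K] (d : ℕ)
    (v : DiscreteValuation K) : Prop :=
  v.TrivialOn k ∧ v.ResidueTrdegGe k (d - 1) ∧ ¬ v.ResidueTrdegGe k d

/-- `Δ_A`: the set of subgroups `A ⊓ 𝔘_v`, for `v` ranging over the divisorial-type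
valuations of `K` with `A ⊄ 𝔘_v`. -/
def DeltaA (ℓ : ℕ) (k : Type*) {K : Type*} [Field k] [Field K] [Algebra k K] (d : ℕ)
    (A : Subgroup (K1 ℓ K)) : Set (Subgroup (K1 ℓ K)) :=
  {T | ∃ v : DiscreteValuation K, IsDivisorialType k d v ∧
    ¬ A ≤ v.unitsImage ℓ ∧ T = A ⊓ v.unitsImage ℓ}

/-- A good rational subgroup: a rational subgroup `A = Ω_K(k(t))` such that for every
discrete valuation `w` of `k(t)` trivial on `k`, the image of `U_w` in `K^×/(K^×)^ℓ`
belongs to `Δ_A`. -/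
def IsGoodRationalSubgroup (ℓ : ℕ) (k : Type*) {K : Type*} [Field k] [Field K] [Algebra k K]
    (d : ℕ) (A : Subgroup (K1 ℓ K)) : Prop :=
  ∃ t : K, IsGeneralElement k t ∧ A = Omega ℓ (IntermediateField.adjoin k {t}) ∧
    ∀ w : DiscreteValuation (IntermediateField.adjoin k {t}), w.TrivialOn k →
      unitsImageIn ℓ (IntermediateField.adjoin k {t}) w ∈ DeltaA ℓ k d A

/-- A very general element: a general element `t` such that `Ω_K(k(t))` is a good
rational subgroup. -/
def IsVeryGeneral (ℓ : ℕ) (k : Type*) {K : Type*} [Field k] [Field K] [Algebra k K]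
    (d : ℕ) (t : K) : Prop :=
  IsGeneralElement k t ∧ IsGoodRationalSubgroup ℓ k d (Omega ℓ (IntermediateField.adjoin k {t}))

/-- `x` is separable in `K`: in characteristic `p > 0`, `x` is not a `p`-th power;
in characteristic `0` every element is separable. -/
def IsSeparableIn (K : Type*) [Field K] (x : K) : Prop :=
  ∀ p : ℕ, p.Prime → CharP K p → ¬ ∃ y : K, y ^ p = x

/-- A perfect closure of `K`: a perfect field which is a purely inseparable
extension of `K`. -/
structure PerfectClosureOf (K : Type u) [Field K] : Type (u + 1) where
  carrier : Type u
  [fieldInst : Field carrier]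
  [algebraInst : Algebra K carrier]
  purelyInseparable : IsPurelyInseparable K carrier
  perfect : PerfectField carrier

attribute [instance] PerfectClosureOf.fieldInst PerfectClosureOf.algebraInst

/-- A group isomorphism `φ : k^M_1(K) → k^M_1(L)` is induced by a field isomorphism
`σ : K^i → L^i` of the perfect closures, via the canonical identifications
`k^M_1(K) ≅ k^M_1(K^i)` and `k^M_1(L) ≅ k^M_1(L^i)`. -/
def InducesOnK1 (ℓ : ℕ) {K : Type u} {L : Type v} [Field K] [Field L]
    (PK : PerfectClosureOf K) (PL : PerfectClosureOf L)
    (σ : PK.carrier ≃+* PL.carrier) (φ : K1 ℓ K ≃* K1 ℓ L) : Prop :=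
  ∀ (x : Kˣ) (y : Lˣ),
    (φ (K1proj ℓ K x) = K1proj ℓ L y ↔
      ∃ z : (PL.carrier)ˣ,
        Units.map σ.toRingHom.toMonoidHom
            (Units.map (algebraMap K PK.carrier).toMonoidHom x) =
          Units.map (algebraMap L PL.carrier).toMonoidHom y * z ^ ℓ)

/-- `φ : k^M_1(K) → k^M_1(L)` is compatible with `k^M_2`: `φ ⊗ φ` descends, along the
multiplication maps, to an isomorphism `k^M_2(K) → k^M_2(L)`; equivalently, there is an
additive isomorphism `k^M_2(K) ≃ k^M_2(L)` carrying `{a, b}` to `{a', b'}` whenever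
`φ` carries the class of `a` (resp. `b`) to the class of `a'` (resp. `b'`). -/
def CompatWithK2 (ℓ : ℕ) {K L : Type*} [Field K] [Field L] (φ : K1 ℓ K ≃* K1 ℓ L) : Prop :=
  ∃ ψ : MilnorKMod ℓ 2 K ≃+ MilnorKMod ℓ 2 L,
    ∀ (a b : Kˣ) (a' b' : Lˣ),
      φ (K1proj ℓ K a) = K1proj ℓ L a' → φ (K1proj ℓ K b) = K1proj ℓ L b' →
        ψ (milnorSymbol ℓ ![a, b]) = milnorSymbol ℓ ![a', b']

/-- `φ : k^M_1(K) → k^M_1(L)` is compatible with `𝔊^1_rat`: it maps rational subgroups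
bijectively onto rational subgroups. -/
def CompatWithRat (ℓ : ℕ) (k : Type*) (l : Type*) {K L : Type*}
    [Field k] [Field K] [Algebra k K] [Field l] [Field L] [Algebra l L]
    (φ : K1 ℓ K ≃* K1 ℓ L) : Prop :=
  (∀ A : Subgroup (K1 ℓ K), IsRationalSubgroup ℓ k A →
     IsRationalSubgroup ℓ l (A.map φ.toMonoidHom)) ∧
  (∀ B : Subgroup (K1 ℓ L), IsRationalSubgroup ℓ l B →
     ∃ A : Subgroup (K1 ℓ K), IsRationalSubgroup ℓ k A ∧ A.map φ.toMonoidHom = B)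

/-- Two isomorphisms of perfect closures differ by a power of the Frobenius
(in characteristic `0`, they are equal). -/
def FrobTwistEquiv {Ki Li : Type*} [Field Ki] [Field Li] (σ σ' : Ki ≃+* Li) : Prop :=
  σ = σ' ∨ ∃ p : ℕ, p.Prime ∧ CharP Ki p ∧
    ((∃ n : ℕ, ∀ x, σ' x = σ (x ^ p ^ n)) ∨ (∃ n : ℕ, ∀ x, σ x = σ' (x ^ p ^ n)))

universe w

open Polynomial in
/-- Hensel's lemma for power series over a field: a simple root of the constant-term reduction of
a monic polynomial lifts. -/
theorem PowerSeries.exists_root_of_simple_root {E : Type*} [Field E] (f : (PowerSeries E)[X])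
    (hf : f.Monic) (r : E) (hr : f.eval₂ PowerSeries.constantCoeff r = 0)
    (hr' : f.derivative.eval₂ PowerSeries.constantCoeff r ≠ 0) :
    ∃ a : PowerSeries E, f.eval a = 0 := by
  have hC : ∀ g : (PowerSeries E)[X], PowerSeries.constantCoeff (g.eval (PowerSeries.C r)) =
      g.eval₂ PowerSeries.constantCoeff r := by
    intro g
    rw [← Polynomial.eval₂_at_apply, PowerSeries.constantCoeff_C]
  obtain ⟨a, ha, -⟩ := HenselianRing.is_henselian (I := Ideal.span {(PowerSeries.X : PowerSeries E)})
    f hf (PowerSeries.C r)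
    (by rw [Ideal.mem_span_singleton, PowerSeries.X_dvd_iff, hC, hr])
    (IsUnit.map _ (by
      rw [PowerSeries.isUnit_iff_constantCoeff, hC]
      exact isUnit_iff_ne_zero.2 hr'))
  exact ⟨a, ha⟩

open Polynomial in
/-- A finite separable extension of `Frac R` has a primitive polynomial `Φ` and a nonzero
`D ∈ R` such that every embedding of `R` into a power series ring for which `Φ` has a root
in the constant-term reduction, and `D` does not vanish there, extends to Laurent series. -/
theorem exists_laurent_lift_of_separable (R F L : Type*) [CommRing R] [IsDomain R]
    [IsIntegrallyClosed R] [Field F] [Algebra R F] [IsFractionRing R F] [Field L] [Algebra F L]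
    [Algebra R L] [IsScalarTower R F L] [FiniteDimensional F L] [Algebra.IsSeparable F L] :
    ∃ (Φ : R[X]) (D : R), Φ.Monic ∧ Φ.natDegree ≠ 0 ∧ D ≠ 0 ∧
      ∀ (E : Type w) [Field E] (ψ : R →+* PowerSeries E), Function.Injective ψ →
        (∃ r : E, Φ.eval₂ (PowerSeries.constantCoeff.comp ψ) r = 0) →
        PowerSeries.constantCoeff (ψ D) ≠ 0 →
        ∃ Ψ : L →+* LaurentSeries E, ∀ x : R,
          Ψ (algebraMap R L x) = HahnSeries.ofPowerSeries ℤ E (ψ x) := by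
  obtain ⟨α, hα⟩ := Field.exists_primitive_element F L
  obtain ⟨m, hm⟩ := IsIntegral.exists_multiple_integral_of_isLocalization (nonZeroDivisors R)
    (Rₘ := F) α (Algebra.IsIntegral.isIntegral α)
  have hm0 : algebraMap R F (m : R) ≠ 0 :=
    IsFractionRing.to_map_ne_zero_of_mem_nonZeroDivisors m.2
  set θ : L := m • α with hθ
  have hθ' : θ = algebraMap F L (algebraMap R F m) * α := by
    rw [hθ, Submonoid.smul_def, Algebra.smul_def, ← IsScalarTower.algebraMap_apply]
  have hθF : IsIntegral F θ := Algebra.IsIntegral.isIntegral θ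
  have htop : Algebra.adjoin F {θ} = ⊤ := by
    rw [← IntermediateField.adjoin_simple_toSubalgebra_of_isAlgebraic hθF.isAlgebraic]
    have : IntermediateField.adjoin F {θ} = ⊤ := by
      rw [← top_le_iff, ← hα, IntermediateField.adjoin_simple_le_iff]
      have h1 := IntermediateField.mem_adjoin_simple_self F θ
      have h2 : α = algebraMap F L (algebraMap R F m)⁻¹ * θ := by
        rw [hθ', ← mul_assoc, ← map_mul, inv_mul_cancel₀ hm0, map_one, one_mul]
      rw [h2]
      exact mul_mem (IntermediateField.algebraMap_mem _ _) h1
    rw [this]; rfl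
  let pb := PowerBasis.ofAdjoinEqTop hθF htop
  have hgen : pb.gen = θ := PowerBasis.ofAdjoinEqTop_gen hθF htop
  have hmin : minpoly F θ = (minpoly R θ).map (algebraMap R F) :=
    minpoly.isIntegrallyClosed_eq_field_fractions' F hm
  have hsep : (minpoly F θ).Separable := Algebra.IsSeparable.isSeparable F θ
  obtain ⟨U, V, hUV⟩ := (Polynomial.separable_def _).1 hsep
  obtain ⟨bU, hbU, hU⟩ := IsLocalization.integerNormalization_spec (nonZeroDivisors R) U
  obtain ⟨bV, hbV, hV⟩ := IsLocalization.integerNormalization_spec (nonZeroDivisors R) V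
  set U' := IsLocalization.integerNormalization (nonZeroDivisors R) U
  set V' := IsLocalization.integerNormalization (nonZeroDivisors R) V
  have hD : C bV * U' * minpoly R θ + C bU * V' * derivative (minpoly R θ) = C (bU * bV) := by
    apply Polynomial.map_injective (algebraMap R F) (IsFractionRing.injective R F)
    have hU2 : U'.map (algebraMap R F) = C (algebraMap R F bU) * U := by
      rw [hU]; ext; simp [Algebra.smul_def]
    have hV2 : V'.map (algebraMap R F) = C (algebraMap R F bV) * V := by
      rw [hV]; ext; simp [Algebra.smul_def]
    simp only [Polynomial.map_add, Polynomial.map_mul, Polynomial.map_C, hU2, hV2,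
      ← Polynomial.derivative_map, ← hmin, map_mul]
    linear_combination C (algebraMap R F bU) * C (algebraMap R F bV) * hUV
  refine ⟨minpoly R θ, bU * bV, minpoly.monic hm, (minpoly.natDegree_pos hm).ne',
    mul_ne_zero (nonZeroDivisors.ne_zero hbU) (nonZeroDivisors.ne_zero hbV), ?_⟩
  intro E _ ψ hψ ⟨r, hr⟩ hD0
  have hder : (derivative (minpoly R θ)).eval₂ (PowerSeries.constantCoeff.comp ψ) r ≠ 0 := by
    intro h0
    apply hD0
    have := congrArg (Polynomial.eval₂ (PowerSeries.constantCoeff.comp ψ) r) hD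
    simpa [Polynomial.eval₂_add, Polynomial.eval₂_mul, hr, h0] using this.symm
  obtain ⟨a, ha⟩ := PowerSeries.exists_root_of_simple_root ((minpoly R θ).map ψ)
    ((minpoly.monic hm).map ψ) r (by rwa [Polynomial.eval₂_map])
    (by rwa [Polynomial.derivative_map, Polynomial.eval₂_map])
  have hinj : Function.Injective ((HahnSeries.ofPowerSeries ℤ E).comp ψ) :=
    HahnSeries.ofPowerSeries_injective.comp hψ
  let Ψ0 : F →+* LaurentSeries E := IsFractionRing.lift hinj
  let _ : Algebra F (LaurentSeries E) := Ψ0.toAlgebra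
  have hΨ0 : ∀ x, algebraMap F (LaurentSeries E) (algebraMap R F x) =
      HahnSeries.ofPowerSeries ℤ E (ψ x) := fun x => IsFractionRing.lift_algebraMap hinj x
  let Ψ : L →ₐ[F] LaurentSeries E := pb.lift (HahnSeries.ofPowerSeries ℤ E a) (by
    rw [hgen, hmin, Polynomial.aeval_def, Polynomial.eval₂_map]
    have : (algebraMap F (LaurentSeries E)).comp (algebraMap R F) =
        (HahnSeries.ofPowerSeries ℤ E).comp ψ := RingHom.ext hΨ0
    rw [this, ← Polynomial.eval₂_map, Polynomial.eval₂_hom, ha, map_zero])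
  refine ⟨Ψ.toRingHom, fun x => ?_⟩
  rw [IsScalarTower.algebraMap_apply R F L]
  exact (Ψ.commutes _).trans (hΨ0 x)

open Polynomial in
/-- The same for an arbitrary finite extension, up to a power of Frobenius. -/
theorem exists_laurent_lift (R F L : Type*) [CommRing R] [IsDomain R]
    [IsIntegrallyClosed R] [Field F] [Algebra R F] [IsFractionRing R F] [Field L] [Algebra F L]
    [Algebra R L] [IsScalarTower R F L] [FiniteDimensional F L] (p : ℕ) [ExpChar F p] :
    ∃ (n : ℕ) (Φ : R[X]) (D : R), Φ.Monic ∧ Φ.natDegree ≠ 0 ∧ D ≠ 0 ∧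
      ∀ (E : Type w) [Field E] (ψ : R →+* PowerSeries E), Function.Injective ψ →
        (∃ r : E, Φ.eval₂ (PowerSeries.constantCoeff.comp ψ) r = 0) →
        PowerSeries.constantCoeff (ψ D) ≠ 0 →
        ∃ Ψ : L →+* LaurentSeries E, ∀ x : R,
          Ψ (algebraMap R L x) = HahnSeries.ofPowerSeries ℤ E (ψ x) ^ p ^ n := by
  obtain ⟨Φ, D, h1, h2, h3, h4⟩ := exists_laurent_lift_of_separable R F (separableClosure F L)
  have : ExpChar (separableClosure F L) p := expChar_of_injective_algebraMap
    (algebraMap F (separableClosure F L)).injective p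
  refine ⟨IsPurelyInseparable.exponent (separableClosure F L) L, Φ, D, h1, h2, h3, ?_⟩
  intro E _ ψ hψ hr hD
  obtain ⟨Ψ, hΨ⟩ := h4 E ψ hψ hr hD
  refine ⟨Ψ.comp (IsPurelyInseparable.iterateFrobenius (separableClosure F L) L p le_rfl),
    fun x => ?_⟩
  have hx : algebraMap R L x = algebraMap (separableClosure F L) L (algebraMap R _ x) := by
    rw [IsScalarTower.algebraMap_apply R F L, IsScalarTower.algebraMap_apply R F
      (separableClosure F L), ← IsScalarTower.algebraMap_apply F (separableClosure F L) L]
  rw [RingHom.comp_apply, hx,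
    IsPurelyInseparable.iterateFrobenius_algebraMap, map_pow, hΨ]

namespace DiscreteValuation

variable {F : Type*} [Field F] (v : DiscreteValuation F)

theorem v_inv (x : Fˣ) : v.v x⁻¹ = -v.v x := by
  have h := v.map_mul' x x⁻¹
  rw [mul_inv_cancel, v.v_one] at h
  omega

theorem v_div (x y : Fˣ) : v.v (x / y) = v.v x - v.v y := by
  rw [div_eq_mul_inv, v.map_mul', v.v_inv, sub_eq_add_neg]

theorem v_pow (x : Fˣ) (n : ℕ) : v.v (x ^ n) = n * v.v x := by
  induction n with
  | zero => simp [v.v_one]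
  | succ n ih => rw [pow_succ, v.map_mul', ih]; push_cast; ring

theorem v_zpow (x : Fˣ) (n : ℤ) : v.v (x ^ n) = n * v.v x := by
  cases n with
  | ofNat n => simp [v.v_pow]
  | negSucc n => rw [zpow_negSucc, v.v_inv, v.v_pow, Int.negSucc_eq]; push_cast; ring

theorem v_neg (x : Fˣ) : v.v (-x) = v.v x := by
  have h := v.map_mul' (-1) (-1)
  rw [neg_mul_neg, one_mul, v.v_one] at h
  have h2 := v.map_mul' (-1) x
  rw [neg_one_mul] at h2
  omega

theorem v_eq_of_add_of_lt {x y z : Fˣ} (h : (x : F) + y = z) (hlt : v.v x < v.v y) :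
    v.v z = v.v x := by
  have h1 := v.min_le' x y z h
  have h2 := v.min_le' z (-y) x (by rw [← h]; simp)
  rw [v.v_neg] at h2
  omega

/-- The valuation ring of a discrete valuation. -/
def integers : Subring F where
  carrier := {x | ∀ u : Fˣ, (u : F) = x → 0 ≤ v.v u}
  zero_mem' := fun u hu => absurd hu u.ne_zero
  one_mem' := fun u hu => by rw [Units.val_eq_one.1 hu, v.v_one]
  mul_mem' := by
    intro a b ha hb u hu
    have hab : a * b ≠ 0 := hu ▸ u.ne_zero
    have : u = Units.mk0 a (left_ne_zero_of_mul hab) * Units.mk0 b (right_ne_zero_of_mul hab) :=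
      Units.ext hu
    rw [this, v.map_mul']
    exact add_nonneg (ha _ rfl) (hb _ rfl)
  add_mem' := by
    intro a b ha hb u hu
    by_cases ha0 : a = 0
    · exact hb u (by rw [hu, ha0, zero_add])
    by_cases hb0 : b = 0
    · exact ha u (by rw [hu, hb0, add_zero])
    exact (le_min (ha (Units.mk0 a ha0) rfl) (hb (Units.mk0 b hb0) rfl)).trans
      (v.min_le' _ _ u hu.symm)
  neg_mem' := by
    intro a ha u hu
    rw [← v.v_neg]
    exact ha _ (by simp [hu])

theorem mem_integers {x : Fˣ} (h : 0 ≤ v.v x) : (x : F) ∈ v.integers := by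
  intro u hu
  rwa [Units.ext hu]

/-- A discrete valuation which is trivial on a domain is trivial on everything algebraic
over it. -/
theorem v_eq_zero_of_isAlgebraic {A : Type*} [CommRing A] [Algebra A F]
    (h : ∀ a : A, a ≠ 0 → ∃ u : Fˣ, (u : F) = algebraMap A F a ∧ v.v u = 0)
    (x : Fˣ) (hx : IsAlgebraic A (x : F)) : v.v x = 0 := by
  have key : ∀ y : Fˣ, IsAlgebraic A (y : F) → ¬ 0 < v.v y := by
    intro y hy hpos
    obtain ⟨p, hp, hp0⟩ := hy.exists_nonzero_coeff_and_aeval_eq_zero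
      (mem_nonZeroDivisors_of_ne_zero y.ne_zero)
    obtain ⟨u, hu, hu0⟩ := h _ hp
    have hmem : Polynomial.aeval (y : F) p.divX ∈ v.integers := by
      rw [Polynomial.aeval_eq_sum_range]
      refine sum_mem fun i _ => ?_
      rw [Algebra.smul_def]
      refine mul_mem ?_ (pow_mem (v.mem_integers hpos.le) _)
      by_cases hc : p.divX.coeff i = 0
      · rw [hc, map_zero]; exact zero_mem _
      · obtain ⟨u', hu', hu0'⟩ := h _ hc
        rw [← hu']; exact v.mem_integers hu0'.ge
    have heq : (u : F) = -(y * Polynomial.aeval (y : F) p.divX) := by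
      have := congrArg (Polynomial.aeval (y : F)) (Polynomial.X_mul_divX_add p)
      rw [hp0, map_add, map_mul, Polynomial.aeval_X, Polynomial.aeval_C] at this
      rw [hu, eq_neg_iff_add_eq_zero, add_comm, this]
    have hne : Polynomial.aeval (y : F) p.divX ≠ 0 := by
      intro h0
      rw [h0, mul_zero, neg_zero] at heq
      exact u.ne_zero heq
    have : u = -(y * Units.mk0 _ hne) := Units.ext (by simpa using heq)
    rw [this, v.v_neg, v.map_mul'] at hu0
    have := hmem (Units.mk0 _ hne) rfl
    omega
  have h1 := key x hx
  have h2 := key x⁻¹ (by rw [Units.val_inv_eq_inv_val]; exact hx.inv)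
  rw [v.v_inv] at h2
  omega

/-- A nonzero `ℤ`-valued valuation is a positive multiple of a discrete valuation. -/
theorem exists_eq_mul {F : Type*} [Field F] (m : Fˣ → ℤ) (hmul : ∀ x y, m (x * y) = m x + m y)
    (hadd : ∀ x y z : Fˣ, (x : F) + y = z → min (m x) (m y) ≤ m z) (x₀ : Fˣ) (hx₀ : m x₀ ≠ 0) :
    ∃ (v : DiscreteValuation F) (n : ℤ), 0 < n ∧ ∀ x, m x = n * v.v x := by
  let f : Additive Fˣ →+ ℤ := AddMonoidHom.mk' (fun x => m x.toMul) (fun x y => hmul _ _)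
  obtain ⟨g, hg⟩ := Int.subgroup_cyclic f.range
  have hdvd : ∀ x, |g| ∣ m x := by
    intro x
    have : m x ∈ f.range := ⟨Additive.ofMul x, rfl⟩
    rw [hg, ← AddSubgroup.zmultiples_eq_closure, Int.mem_zmultiples_iff] at this
    rwa [abs_dvd]
  have hg0 : 0 < |g| := by
    rw [abs_pos]
    rintro rfl
    have := hdvd x₀
    rw [abs_zero, zero_dvd_iff] at this
    exact hx₀ this
  choose w hw using hdvd
  obtain ⟨y, hy⟩ : ∃ y, m y = |g| := by
    have : |g| ∈ f.range := by
      rw [hg, ← AddSubgroup.zmultiples_eq_closure, Int.mem_zmultiples_iff, dvd_abs]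
    obtain ⟨y, hy⟩ := this
    exact ⟨y.toMul, hy⟩
  have hwmul : ∀ x z, w (x * z) = w x + w z := by
    intro x z
    have := hmul x z
    rw [hw, hw x, hw z, ← mul_add] at this
    exact mul_left_cancel₀ hg0.ne' this
  have hwy : w y = 1 := by
    have := hw y
    rw [hy] at this
    exact mul_left_cancel₀ hg0.ne' (by rw [mul_one]; exact this.symm)
  refine ⟨⟨w, hwmul, fun n => ⟨y ^ n, ?_⟩, ?_⟩, |g|, hg0, hw⟩
  · let W : Fˣ →* Multiplicative ℤ := MonoidHom.mk' (fun x => Multiplicative.ofAdd (w x))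
      (fun a b => by rw [hwmul]; rfl)
    have : W (y ^ n) = W y ^ n := map_zpow W y n
    have h2 := congrArg Multiplicative.toAdd this
    simpa [W, hwy] using h2
  · intro x z s h
    have := hadd x z s h
    rw [hw x, hw z, hw s, ← mul_min_of_nonneg _ _ hg0.le] at this
    exact le_of_mul_le_mul_left this hg0

end DiscreteValuation

/-- The order of a Laurent series. -/
def laurentValuation (E : Type*) [Field E] : DiscreteValuation (LaurentSeries E) where
  v x := HahnSeries.order (x : LaurentSeries E)
  map_mul' x y := HahnSeries.order_mul x.ne_zero y.ne_zero
  surjective' n := by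
    refine ⟨Units.mk0 (HahnSeries.single n 1) (by simp), ?_⟩
    simp [HahnSeries.order_single]
  min_le' x y z h := by
    rw [← h]
    exact HahnSeries.min_order_le_order_add (by rw [h]; exact z.ne_zero)

theorem laurentValuation_eq_zero_of_C {E : Type*} [Field E] (u : (LaurentSeries E)ˣ) (c : E)
    (hu : (u : LaurentSeries E) = HahnSeries.C c) : (laurentValuation E).v u = 0 := by
  change HahnSeries.order (u : LaurentSeries E) = 0
  rw [hu, HahnSeries.order_C]

/-- A field `E` is algebraically closed in `E((X))`. -/
theorem LaurentSeries.exists_eq_C_of_isAlgebraic {E : Type*} [Field E] (x : LaurentSeries E)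
    (hx : IsAlgebraic E x) : ∃ c : E, x = HahnSeries.C c := by
  have hC : ∀ c : E, algebraMap E (LaurentSeries E) c = HahnSeries.C c := fun c => by
    rw [HahnSeries.algebraMap_apply', ← HahnSeries.ofPowerSeries_C]; rfl
  have key : ∀ u : (LaurentSeries E)ˣ, IsAlgebraic E (u : LaurentSeries E) →
      HahnSeries.order (u : LaurentSeries E) = 0 := by
    intro u hu
    refine (laurentValuation E).v_eq_zero_of_isAlgebraic (A := E) (fun a ha => ?_) u hu
    refine ⟨Units.mk0 (algebraMap E _ a) (by simpa using ha), rfl, ?_⟩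
    exact laurentValuation_eq_zero_of_C _ a (hC a)
  refine ⟨x.coeff 0, ?_⟩
  by_contra hne
  have h0 : x - HahnSeries.C (x.coeff 0) ≠ 0 := sub_ne_zero.2 hne
  have halg : IsAlgebraic E (x - HahnSeries.C (x.coeff 0)) :=
    hx.sub (hC (x.coeff 0) ▸ isAlgebraic_algebraMap (A := LaurentSeries E) (x.coeff 0))
  have h1 := key (Units.mk0 _ h0) halg
  have h2 := mt HahnSeries.coeff_order_eq_zero.1 h0
  rw [Units.val_mk0] at h1
  rw [h1] at h2
  simp at h2

section Places

variable {k K : Type*} [Field k] [Field K] [Algebra k K]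

theorem DiscreteValuation.TrivialOn.v_eq_zero {v : DiscreteValuation K} (h : v.TrivialOn k)
    {u : Kˣ} {c : k} (hu : (u : K) = algebraMap k K c) : v.v u = 0 := by
  have hc : algebraMap k K c ≠ 0 := hu ▸ u.ne_zero
  rw [← h c hc]
  exact congrArg v.v (Units.ext hu)

/-- A discrete valuation which is trivial on constants vanishes at all but at most one translate
of an element, when it is positive at that one. -/
theorem DiscreteValuation.TrivialOn.v_translate {v : DiscreteValuation K} (h : v.TrivialOn k)
    {t : K} {x y : Kˣ} {c c' : k} (hx : (x : K) = t - algebraMap k K c)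
    (hy : (y : K) = t - algebraMap k K c') (hne : c ≠ c') (hpos : 0 < v.v x) : v.v y = 0 := by
  have hcc : algebraMap k K (c - c') ≠ 0 := by
    simpa [sub_eq_zero] using hne
  have h0 := h _ hcc
  rw [← h0]
  exact v.v_eq_of_add_of_lt (x := Units.mk0 _ hcc) (y := x) (by rw [hx, hy]; simp) (by rw [h0]; exact hpos)

theorem DiscreteValuation.TrivialOn.v_translate_of_neg {v : DiscreteValuation K}
    (h : v.TrivialOn k) {t : K} {x y : Kˣ} {c c' : k} (hx : (x : K) = t - algebraMap k K c)
    (hy : (y : K) = t - algebraMap k K c') (hneg : v.v x < 0) : v.v y = v.v x := by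
  by_cases hne : c = c'
  · subst hne
    exact congrArg v.v (Units.ext (hy.trans hx.symm))
  have hcc : algebraMap k K (c - c') ≠ 0 := by
    simpa [sub_eq_zero] using hne
  have h0 := h _ hcc
  exact v.v_eq_of_add_of_lt (y := Units.mk0 _ hcc) (x := x) (by rw [hx, hy]; simp) (by rw [h0]; exact hneg)

/-- The inclusion of unit groups. -/
abbrev unitsIncl (F : IntermediateField k K) : Fˣ →* Kˣ :=
  Units.map (algebraMap F K).toMonoidHom

open Polynomial in
/-- Over an algebraically closed field, multiplicative functions on `k(t)^×` which agree on
constants and translates of `t` agree. -/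
theorem eq_of_eq_on_translates [IsAlgClosed k] {t : K} {F : IntermediateField k K}
    (hF : F = IntermediateField.adjoin k {t}) {M : Type*} [CommGroup M] (f g : Fˣ →* M)
    (hc : ∀ (u : Fˣ) (c : k), (unitsIncl F u : K) = algebraMap k K c → f u = g u)
    (ht : ∀ (u : Fˣ) (c : k), (unitsIncl F u : K) = t - algebraMap k K c → f u = g u) :
    f = g := by
  have htF : t ∈ F := hF ▸ IntermediateField.mem_adjoin_simple_self k t
  let S : Submonoid K :=
    { carrier := {x | x ∈ F ∧ ∀ u : Fˣ, (unitsIncl F u : K) = x → f u = g u}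
      one_mem' := by
        refine ⟨one_mem _, fun u hu => ?_⟩
        have : u = 1 := Units.ext (Subtype.ext hu)
        rw [this, map_one, map_one]
      mul_mem' := by
        intro a b ha hb
        refine ⟨mul_mem ha.1 hb.1, fun u hu => ?_⟩
        have hab : a * b ≠ 0 := hu ▸ (unitsIncl F u).ne_zero
        have ha0 := left_ne_zero_of_mul hab
        have hb0 := right_ne_zero_of_mul hab
        have hu' : u = Units.mk0 (⟨a, ha.1⟩ : F) (fun h => ha0 (congrArg Subtype.val h)) *
            Units.mk0 (⟨b, hb.1⟩ : F) (fun h => hb0 (congrArg Subtype.val h)) :=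
          Units.ext (Subtype.ext hu)
        rw [hu', map_mul, map_mul, ha.2 _ rfl, hb.2 _ rfl] }
  have hpoly : ∀ r : k[X], aeval t r ∈ S := by
    intro r
    rw [(IsAlgClosed.splits r).eq_prod_roots, map_mul, map_multiset_prod,
      Multiset.map_map]
    refine mul_mem ?_ (Submonoid.multiset_prod_mem _ _ fun x hx => ?_)
    · rw [aeval_C]
      exact ⟨F.algebraMap_mem _, fun u hu => hc u _ hu⟩
    · obtain ⟨c, -, rfl⟩ := Multiset.mem_map.1 hx
      simp only [Function.comp_apply, map_sub, aeval_X, aeval_C]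
      exact ⟨sub_mem htF (F.algebraMap_mem _), fun u hu => ht u _ hu⟩
  ext u
  obtain ⟨r, s, hrs⟩ := (IntermediateField.mem_adjoin_simple_iff k ((u : F) : K)).1
    (hF.le (u : F).2)
  have hr := hpoly r
  have hs := hpoly s
  have hu0 : ((u : F) : K) ≠ 0 := (unitsIncl F u).ne_zero
  have hr0 : aeval t r ≠ 0 := by
    intro h; rw [hrs, h, zero_div] at hu0; exact hu0 rfl
  have hs0 : aeval t s ≠ 0 := by
    intro h; rw [hrs, h, div_zero] at hu0; exact hu0 rfl
  have hu' : u = Units.mk0 (⟨_, hr.1⟩ : F) (fun h => hr0 (congrArg Subtype.val h)) /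
      Units.mk0 (⟨_, hs.1⟩ : F) (fun h => hs0 (congrArg Subtype.val h)) := by
    apply Units.ext
    apply Subtype.ext
    rw [hrs, Units.val_div_eq_div_val]
    rfl
  rw [hu', _root_.map_div, _root_.map_div, hr.2 _ rfl, hs.2 _ rfl]

/-- If the restriction of a divisorial valuation `v` to `k(t)` is proportional to `w`, with
ramification prime to `ℓ`, then `w` is visible in `Δ`. -/
theorem unitsImageIn_mem_DeltaA {ℓ : ℕ} (hℓ : ℓ.Prime) (d : ℕ) (F : IntermediateField k K)
    (w : DiscreteValuation F) (v : DiscreteValuation K) (hv : IsDivisorialType k d v)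
    (a e : ℤ) (ha : a ≠ 0) (he : ¬ (ℓ : ℤ) ∣ e)
    (h : ∀ x : Fˣ, a * v.v (unitsIncl F x) = e * w.v x) :
    unitsImageIn ℓ F w ∈ DeltaA ℓ k d (Omega ℓ F) := by
  obtain ⟨y, hy⟩ := w.surjective' 1
  obtain ⟨e', he'⟩ : a ∣ e := ⟨v.v (unitsIncl F y), by rw [h y, hy, mul_one]⟩
  have hve : ∀ x : Fˣ, v.v (unitsIncl F x) = e' * w.v x := fun x =>
    mul_left_cancel₀ ha (by rw [h, he', mul_assoc])
  have he0 : ¬ (ℓ : ℤ) ∣ e' := fun hd => he (he' ▸ hd.mul_left a)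
  have hℓ' : Prime (ℓ : ℤ) := Nat.prime_iff_prime_int.1 hℓ
  have hmem : ∀ x : Fˣ, K1proj ℓ K (unitsIncl F x) ∈ Omega ℓ F := fun x =>
    Subgroup.mem_map_of_mem _ (show ((x : F) : K) ∈ F from (x : F).2)
  have hunit : ∀ x : Kˣ, K1proj ℓ K x ∈ v.unitsImage ℓ → (ℓ : ℤ) ∣ v.v x := by
    rintro x ⟨u, hu, hux⟩
    obtain ⟨z, hz⟩ := QuotientGroup.eq.1 hux
    have hx : x = u * z ^ ℓ := by
      rw [powMonoidHom_apply] at hz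
      rw [hz, mul_inv_cancel_left]
    have hu0 : v.v u = 0 := hu
    rw [hx, v.map_mul', hu0, v.v_pow, zero_add]
    exact dvd_mul_right _ _
  refine ⟨v, hv, fun hle => ?_, le_antisymm ?_ ?_⟩
  · have := hunit _ (hle (hmem y))
    rw [hve, hy, mul_one] at this
    exact he0 this
  · rintro _ ⟨_, ⟨x, hx, rfl⟩, rfl⟩
    have hx0 : w.v x = 0 := hx
    refine ⟨hmem x, Subgroup.mem_map_of_mem _ ?_⟩
    change v.v (unitsIncl F x) = 0
    rw [hve, hx0, mul_zero]
  · rintro _ ⟨⟨x', hx', rfl⟩, hxv⟩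
    have hx0 : (⟨x', hx'⟩ : F) ≠ 0 := fun h => x'.ne_zero (congrArg Subtype.val h)
    set x : Fˣ := Units.mk0 _ hx0
    have hxx : x' = unitsIncl F x := Units.ext rfl
    rw [hxx] at hxv ⊢
    have h1 := hunit _ hxv
    rw [hve] at h1
    obtain ⟨n, hn⟩ := (hℓ'.dvd_or_dvd h1).resolve_left he0
    refine ⟨unitsIncl F (x * (y ^ (-n)) ^ ℓ), Subgroup.mem_map_of_mem _ ?_, ?_⟩
    · change w.v _ = 0
      rw [w.map_mul', w.v_pow, w.v_zpow, hy, hn]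
      ring
    · refine QuotientGroup.eq.2 ⟨unitsIncl F (y ^ n), ?_⟩
      simp [mul_comm]

/-- A criterion for being very general: every place of `k(t)` is visible through a divisorial
valuation whose ramification index is prime to `ℓ`. -/
theorem isVeryGeneral_of_places [IsAlgClosed k] {ℓ : ℕ} (hℓ : ℓ.Prime) {d : ℕ} {t : K}
    (ht : IsGeneralElement k t)
    (hfin : ∀ c : k, ∃ v : DiscreteValuation K, IsDivisorialType k d v ∧
      ∃ u : Kˣ, (u : K) = t - algebraMap k K c ∧ 0 < v.v u ∧ ¬ (ℓ : ℤ) ∣ v.v u)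
    (hinf : ∃ v : DiscreteValuation K, IsDivisorialType k d v ∧
      ∃ u : Kˣ, (u : K) = t ∧ v.v u < 0 ∧ ¬ (ℓ : ℤ) ∣ v.v u) :
    IsVeryGeneral ℓ k d t := by
  refine ⟨ht, t, ht, rfl, fun w hw => ?_⟩
  generalize hF : IntermediateField.adjoin k {t} = F at *
  have htF : t ∈ F := hF ▸ IntermediateField.mem_adjoin_simple_self k t
  have htk : ∀ c : k, (⟨t, htF⟩ : F) - algebraMap k F c ≠ 0 := by
    intro c h
    refine ht.1 ⟨c, ?_⟩
    exact (sub_eq_zero.1 (congrArg Subtype.val h)).symm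
  let x : k → Fˣ := fun c => Units.mk0 _ (htk c)
  have hx : ∀ c, (unitsIncl F (x c) : K) = t - algebraMap k K c := fun c => rfl
  have compare : ∀ (v : DiscreteValuation K), IsDivisorialType k d v → ∀ a e : ℤ, a ≠ 0 →
      ¬ (ℓ : ℤ) ∣ e → (∀ c, a * v.v (unitsIncl F (x c)) = e * w.v (x c)) →
      unitsImageIn ℓ F w ∈ DeltaA ℓ k d (Omega ℓ F) := by
    intro v hv a e ha he h
    refine unitsImageIn_mem_DeltaA hℓ d F w v hv a e ha he fun z => ?_
    let f : Fˣ →* Multiplicative ℤ := MonoidHom.mk'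
      (fun z => Multiplicative.ofAdd (a * v.v (unitsIncl F z)))
      (fun z z' => by rw [(unitsIncl F).map_mul, v.map_mul', mul_add]; rfl)
    let g : Fˣ →* Multiplicative ℤ := MonoidHom.mk'
      (fun z => Multiplicative.ofAdd (e * w.v z))
      (fun z z' => by rw [w.map_mul', mul_add]; rfl)
    have hfg : f = g := by
      refine eq_of_eq_on_translates hF.symm f g (fun u c hu => ?_) (fun u c hu => ?_)
      · change Multiplicative.ofAdd _ = Multiplicative.ofAdd _
        rw [hv.1.v_eq_zero hu, hw.v_eq_zero (c := c) (Subtype.ext hu), mul_zero, mul_zero]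
      · have : u = x c := Units.ext (Subtype.ext hu)
        rw [this]
        exact congrArg Multiplicative.ofAdd (h c)
    exact congrArg Multiplicative.toAdd (DFunLike.congr_fun hfg z)
  by_cases hpos : ∃ c, 0 < w.v (x c)
  · obtain ⟨c, hc⟩ := hpos
    obtain ⟨v, hv, u, hu, hu0, huℓ⟩ := hfin c
    have hux : u = unitsIncl F (x c) := Units.ext hu
    subst hux
    refine compare v hv (w.v (x c)) (v.v (unitsIncl F (x c))) hc.ne' huℓ fun c' => ?_
    by_cases hcc : c = c'
    · subst hcc; ring
    · rw [hv.1.v_translate (hx c) (hx c') hcc hu0,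
        hw.v_translate (t := ⟨t, htF⟩) (x := x c) (y := x c') rfl rfl hcc hc, mul_zero, mul_zero]
  · push Not at hpos
    obtain ⟨v, hv, u, hu, hu0, huℓ⟩ := hinf
    have hux : u = unitsIncl F (x 0) := Units.ext (by rw [hx, map_zero, sub_zero, hu])
    subst hux
    have hneg : ∃ c, w.v (x c) < 0 := by
      by_contra! hcon
      have h0 : ∀ c, w.v (x c) = 0 := fun c => le_antisymm (hpos c) (hcon c)
      let g : Fˣ →* Multiplicative ℤ := MonoidHom.mk'
        (fun z => Multiplicative.ofAdd (w.v z)) (fun z z' => by rw [w.map_mul']; rfl)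
      have hg : g = 1 := by
        refine eq_of_eq_on_translates hF.symm g 1 (fun u c hu => ?_) (fun u c hu => ?_)
        · exact congrArg Multiplicative.ofAdd (hw.v_eq_zero (c := c) (Subtype.ext hu))
        · have : u = x c := Units.ext (Subtype.ext hu)
          rw [this]
          exact congrArg Multiplicative.ofAdd (h0 c)
      obtain ⟨z, hz⟩ := w.surjective' 1
      have h1 : w.v z = 0 := congrArg Multiplicative.toAdd (DFunLike.congr_fun hg z)
      omega
    obtain ⟨c₀, hc₀⟩ := hneg
    have hall : ∀ c, w.v (x c) = w.v (x c₀) := fun c =>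
      hw.v_translate_of_neg (t := ⟨t, htF⟩) (x := x c₀) (y := x c) rfl rfl hc₀
    refine compare v hv (w.v (x c₀)) (v.v (unitsIncl F (x 0))) hc₀.ne huℓ fun c' => ?_
    rw [hall c', hv.1.v_translate_of_neg (hx 0) (hx c') hu0, mul_comm]

end Places

section Divisorial

variable {k K : Type*} [Field k] [Field K] [Algebra k K]

theorem isDivisorialType_of_residueTrdegGe {d : ℕ} (hd : HasTrdeg k K d) {v : DiscreteValuation K}
    (hv : v.ResidueTrdegGe k (d - 1)) : IsDivisorialType k d v := by
  refine ⟨fun c hc => ?_, hv, fun ⟨x, _, hP⟩ => ?_⟩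
  · obtain ⟨x, -, hP⟩ := hv
    have hc0 : (MvPolynomial.C c : MvPolynomial (Fin (d - 1)) k) ≠ 0 := by
      rw [Ne, MvPolynomial.C_eq_zero]
      rintro rfl
      exact hc (map_zero _)
    obtain ⟨u, hu, hu0⟩ := hP _ hc0
    rw [← hu0]
    exact congrArg v.v (Units.ext (by rw [hu, MvPolynomial.aeval_C]; rfl))
  · have hx : AlgebraicIndependent k fun i => (x i : K) := by
      rw [algebraicIndependent_iff]
      intro P h0
      by_contra hne
      obtain ⟨u, hu, -⟩ := hP P hne
      exact u.ne_zero (hu.trans h0)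
    obtain ⟨b, hb⟩ := hd
    have htr := hx.isTranscendenceBasis_of_lift_trdeg_le_of_finite
      (by rw [← hb.lift_cardinalMk_eq_trdeg])
    have halg := htr.isAlgebraic
    obtain ⟨y, hy⟩ := v.surjective' 1
    have := v.v_eq_zero_of_isAlgebraic
      (A := Algebra.adjoin k (Set.range fun i => (x i : K))) (fun a ha => ?_) y
      (halg.isAlgebraic _)
    · omega
    · obtain ⟨P, hPa⟩ := (Algebra.adjoin_range_eq_range_aeval k fun i => (x i : K)).le a.2
      obtain ⟨u, hu, hu0⟩ := hP P (by
        rintro rfl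
        exact ha (Subtype.ext (by rw [← hPa]; simp)))
      exact ⟨u, hu.trans hPa, hu0⟩

/-- A field embedding into Laurent series for which enough independent elements are sent to
constants induces a divisorial valuation. -/
theorem exists_divisorial_of_laurent {d ℓ : ℕ} (hd : HasTrdeg k K d) {E : Type*} [Field E]
    (Ψ : K →+* LaurentSeries E) {τ : Type*} (e : Fin (d - 1) ≃ τ) (y : τ → K)
    (hy : ∀ P : MvPolynomial τ k, P ≠ 0 →
      ∃ c : E, c ≠ 0 ∧ Ψ (MvPolynomial.aeval y P) = HahnSeries.C c)
    (L : K) {N : ℕ} (hN : N ≠ 0) (hℓN : ¬ ℓ ∣ N)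
    (hL : Ψ L = HahnSeries.ofPowerSeries ℤ E PowerSeries.X ^ N) :
    ∃ v : DiscreteValuation K, IsDivisorialType k d v ∧
      (∀ u : Kˣ, (u : K) = L → 0 < v.v u ∧ ¬ (ℓ : ℤ) ∣ v.v u) ∧
      ∀ (i : τ) (u : Kˣ), (u : K) = y i → v.v u = 0 := by
  let φ : Kˣ →* (LaurentSeries E)ˣ := Units.map Ψ.toMonoidHom
  let ω := laurentValuation E
  have hXne : (HahnSeries.ofPowerSeries ℤ E PowerSeries.X : LaurentSeries E) ≠ 0 := by
    rw [HahnSeries.ofPowerSeries_X]; simp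
  have hmL : ∀ u : Kˣ, (u : K) = L → ω.v (φ u) = N := by
    intro u hu
    have : φ u = Units.mk0 _ hXne ^ N := Units.ext (by
      rw [Units.val_pow_eq_pow_val, Units.val_mk0, ← hL, ← hu]; rfl)
    rw [this, ω.v_pow]
    have h1 : ω.v (Units.mk0 _ hXne) = 1 := by
      change HahnSeries.order (HahnSeries.ofPowerSeries ℤ E PowerSeries.X : LaurentSeries E) = 1
      rw [HahnSeries.ofPowerSeries_X, HahnSeries.order_single one_ne_zero]
    rw [h1, mul_one]
  have hL0 : L ≠ 0 := by
    rintro rfl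
    rw [map_zero] at hL
    exact pow_ne_zero N hXne hL.symm
  obtain ⟨v, n, hn, hv⟩ := DiscreteValuation.exists_eq_mul (fun u => ω.v (φ u))
    (fun a b => by rw [map_mul, ω.map_mul'])
    (fun a b c h => ω.min_le' _ _ _ (by
      change Ψ a + Ψ b = Ψ c
      rw [← map_add, h])) (Units.mk0 L hL0) (by rw [hmL _ rfl]; exact_mod_cast hN)
  have hzero : ∀ (u : Kˣ) (P : MvPolynomial τ k), P ≠ 0 → (u : K) = MvPolynomial.aeval y P →
      v.v u = 0 := by
    intro u P hP hu
    obtain ⟨c, hc0, hc⟩ := hy P hP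
    have h1 := laurentValuation_eq_zero_of_C (φ u) c (by rw [← hc, ← hu]; rfl)
    have h2 := hv u
    rw [h1] at h2
    exact (mul_eq_zero.1 h2.symm).resolve_left hn.ne'
  have hne : ∀ P : MvPolynomial τ k, P ≠ 0 → MvPolynomial.aeval y P ≠ 0 := by
    intro P hP h0
    obtain ⟨c, hc0, hc⟩ := hy P hP
    rw [h0, map_zero] at hc
    exact hc0 (by simpa using hc.symm)
  have hX : ∀ i, MvPolynomial.aeval y (MvPolynomial.X i : MvPolynomial τ k) = y i :=
    fun i => MvPolynomial.aeval_X _ _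
  refine ⟨v, isDivisorialType_of_residueTrdegGe hd
    ⟨fun i => Units.mk0 (y (e i)) (hX (e i) ▸ hne _ (MvPolynomial.X_ne_zero _)),
      fun i => hzero _ _ (MvPolynomial.X_ne_zero (e i)) (hX _).symm, fun P hP => ?_⟩,
    fun u hu => ?_, fun i u hu => hzero u _ (MvPolynomial.X_ne_zero i) (by rw [hX, hu])⟩
  · have hP' : MvPolynomial.rename e P ≠ 0 := by
      rwa [Ne, map_eq_zero_iff _ (MvPolynomial.rename_injective _ e.injective)]
    refine ⟨Units.mk0 _ (hne _ hP'), ?_, hzero _ _ hP' rfl⟩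
    rw [Units.val_mk0, MvPolynomial.aeval_rename]
    rfl
  · have h1 := hv u
    rw [hmL u hu] at h1
    constructor
    · by_contra! h
      have : n * v.v u ≤ 0 := mul_nonpos_of_nonneg_of_nonpos hn.le h
      omega
    · intro h
      have : (ℓ : ℤ) ∣ N := h1 ▸ h.mul_left n
      exact hℓN (by exact_mod_cast this)

end Divisorial

section BaseSeries

open MvPolynomial

variable {k τ E : Type*} [Field k] [Field E]

/-- The ring homomorphism `k[X₀, Xᵢ : i ∈ τ] → E⟦X⟧` with `X₀ ↦ X` which is given by `j` on the
other variables. -/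
def seriesHom (j : MvPolynomial τ k →+* E) : MvPolynomial (Option τ) k →+* PowerSeries E :=
  eval₂Hom (PowerSeries.C.comp (j.comp C)) fun i => i.elim PowerSeries.X fun i =>
    PowerSeries.C (j (X i))

theorem seriesHom_X_none (j : MvPolynomial τ k →+* E) :
    seriesHom j (X none) = PowerSeries.X := by
  simp [seriesHom]

theorem seriesHom_rename (j : MvPolynomial τ k →+* E) (P : MvPolynomial τ k) :
    seriesHom j (rename some P) = PowerSeries.C (j P) := by
  have : (seriesHom j).comp (rename some : _ →ₐ[k] _).toRingHom = PowerSeries.C.comp j := by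
    ext <;> simp [seriesHom]
  exact RingHom.congr_fun this P

theorem constantCoeff_seriesHom (j : MvPolynomial τ k →+* E) (Q : MvPolynomial (Option τ) k) :
    PowerSeries.constantCoeff (seriesHom j Q) =
      j (aeval (fun i : Option τ => i.elim 0 X) Q) := by
  have : PowerSeries.constantCoeff.comp (seriesHom j) =
      j.comp (aeval (fun i : Option τ => i.elim 0 (X : τ → MvPolynomial τ k))).toRingHom := by
    refine MvPolynomial.ringHom_ext (fun c => ?_) fun i => ?_
    · simp [seriesHom]
    · cases i <;> simp [seriesHom]
  exact RingHom.congr_fun this Q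

theorem seriesHom_injective {j : MvPolynomial τ k →+* E} (hj : Function.Injective j) :
    Function.Injective (seriesHom j) := by
  have : seriesHom j = (Polynomial.coeToPowerSeries.ringHom.comp (Polynomial.mapRingHom j)).comp
      (optionEquivLeft k τ).toRingEquiv.toRingHom := by
    refine MvPolynomial.ringHom_ext (fun c => ?_) fun i => ?_
    · simp [seriesHom]
    · cases i <;> simp [seriesHom]
  rw [this]
  exact ((Polynomial.coe_injective E).comp (Polynomial.map_injective j hj)).comp
    (optionEquivLeft k τ).injective

/-- Evaluating at a point with vanishing distinguished coordinate detects nonvanishing of the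
constant coefficient. -/
theorem constantCoeff_seriesHom_ne_zero {j : MvPolynomial τ k →+* E} (hj : Function.Injective j)
    {Q : MvPolynomial (Option τ) k} {P : Option τ → k} (hP : P none = 0) (hQ : eval P Q ≠ 0) :
    PowerSeries.constantCoeff (seriesHom j Q) ≠ 0 := by
  rw [constantCoeff_seriesHom, Ne, map_eq_zero_iff j hj]
  intro h0
  apply hQ
  have := congrArg (eval fun i => P (some i)) h0
  rw [map_zero] at this
  rw [← this, aeval_def, MvPolynomial.algebraMap_eq, ← coe_eval₂Hom, ← RingHom.comp_apply]
  refine RingHom.congr_fun (MvPolynomial.ringHom_ext (fun c => ?_) fun i => ?_) Q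
  · simp
  · cases i <;> simp [hP]

end BaseSeries

/-- Every suitable embedding `R → E⟦X⟧` lifts, up to a `q`-power twist, to an embedding of `L`
into `E((X))`. Here `Φ` is a polynomial whose reduction must have a root and `D` an element whose
reduction must not vanish. -/
def HasLaurentLifts (R L : Type*) [CommRing R] [Field L] [Algebra R L] (q : ℕ)
    (Φ : Polynomial R) (D : R) : Prop :=
  ∀ (E : Type w) [Field E] (ψ : R →+* PowerSeries E), Function.Injective ψ →
    (∃ r : E, Φ.eval₂ (PowerSeries.constantCoeff.comp ψ) r = 0) →
    PowerSeries.constantCoeff (ψ D) ≠ 0 →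
    ∃ Ψ : L →+* LaurentSeries E, ∀ x : R,
      Ψ (algebraMap R L x) = HahnSeries.ofPowerSeries ℤ E (ψ x) ^ q

theorem exists_eval₂_eq_zero_of_monic {R E : Type*} [CommRing R] [Field E] [IsAlgClosed E]
    {Φ : Polynomial R} (hΦ : Φ.Monic) (hdeg : Φ.natDegree ≠ 0) (f : R →+* E) :
    ∃ r : E, Φ.eval₂ f r = 0 := by
  obtain ⟨r, hr⟩ := IsAlgClosed.exists_root (Φ.map f) (by
    rw [hΦ.degree_map]
    exact fun h => hdeg (Polynomial.natDegree_eq_of_degree_eq_some h))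
  exact ⟨r, by rwa [Polynomial.IsRoot, Polynomial.eval_map] at hr⟩

section Divisorial

open MvPolynomial

variable {k : Type u} {K : Type*} [Field k] [Field K] [Algebra k K] {τ : Type v}
  [Algebra (MvPolynomial (Option τ) k) K] [IsScalarTower k (MvPolynomial (Option τ) k) K]

/-- In the coordinates given by an automorphism `e` of the polynomial ring, the divisor
`X none = 0` gives rise to a divisorial valuation of `K` as soon as `D` does not vanish on it. -/
theorem HasLaurentLifts.exists_divisorial {d ℓ q : ℕ} (hd : HasTrdeg k K d)
    (ε : Fin (d - 1) ≃ τ) (hq : q ≠ 0) (hℓq : ¬ ℓ ∣ q)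
    {Φ : Polynomial (MvPolynomial (Option τ) k)} {D : MvPolynomial (Option τ) k}
    (hlift : HasLaurentLifts.{max u v} (MvPolynomial (Option τ) k) K q Φ D)
    (hΦ : Φ.Monic) (hdeg : Φ.natDegree ≠ 0)
    (e : MvPolynomial (Option τ) k ≃ₐ[k] MvPolynomial (Option τ) k) (P : Option τ → k)
    (hP : P none = 0) (hPD : eval (fun i => eval P (e (X i))) D ≠ 0) :
    ∃ v : DiscreteValuation K, IsDivisorialType k d v ∧
      (∀ u : Kˣ, (u : K) = algebraMap _ K (e.symm (X none)) → 0 < v.v u ∧ ¬ (ℓ : ℤ) ∣ v.v u) ∧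
      ∀ (i : τ) (u : Kˣ), (u : K) = algebraMap _ K (e.symm (X (some i))) → v.v u = 0 := by
  let E : Type (max u v) := AlgebraicClosure (FractionRing (MvPolynomial τ k))
  let j : MvPolynomial τ k →+* E :=
    (algebraMap (FractionRing (MvPolynomial τ k)) E).comp (algebraMap _ _)
  have hj : Function.Injective j :=
    (algebraMap (FractionRing (MvPolynomial τ k)) E).injective.comp (IsFractionRing.injective _ _)
  have heD : eval P (e D) ≠ 0 := by
    have : (eval P).comp e.toRingEquiv.toRingHom = eval fun i => eval P (e (X i)) := by
      refine MvPolynomial.ringHom_ext (fun c => ?_) fun i => by simp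
      have := e.commutes c
      rw [MvPolynomial.algebraMap_eq] at this
      simp [this]
    rwa [← this] at hPD
  obtain ⟨Ψ, hΨ⟩ := hlift E ((seriesHom j).comp e.toRingEquiv.toRingHom)
    ((seriesHom_injective hj).comp e.injective) (exists_eval₂_eq_zero_of_monic hΦ hdeg _)
    (constantCoeff_seriesHom_ne_zero hj hP heD)
  have hΨ' : ∀ x, Ψ (algebraMap _ K (e.symm x)) =
      HahnSeries.ofPowerSeries ℤ E (seriesHom j x) ^ q := by
    intro x
    rw [hΨ]
    change HahnSeries.ofPowerSeries ℤ E (seriesHom j (e (e.symm x))) ^ q = _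
    rw [e.apply_symm_apply]
  refine exists_divisorial_of_laurent hd Ψ ε (fun i => algebraMap _ K (e.symm (X (some i))))
    (fun Q hQ => ⟨j Q ^ q, pow_ne_zero _ (by rwa [Ne, map_eq_zero_iff j hj]), ?_⟩)
    _ hq hℓq (by rw [hΨ', seriesHom_X_none])
  have : aeval (fun i => algebraMap (MvPolynomial (Option τ) k) K (e.symm (X (some i)))) Q =
      algebraMap _ K (e.symm (rename some Q)) := by
    have : aeval (fun i => algebraMap (MvPolynomial (Option τ) k) K (e.symm (X (some i)))) =
        ((IsScalarTower.toAlgHom k (MvPolynomial (Option τ) k) K).comp e.symm.toAlgHom).comp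
          (rename some) := by
      ext i
      simp
    rw [this]
    rfl
  rw [this, hΨ', seriesHom_rename, HahnSeries.ofPowerSeries_C, map_pow]

end Divisorial

section Coordinates

open MvPolynomial

variable {k σ : Type*} [Field k]

/-- The affine change of coordinates exhibiting `t₁ + a - c (t₂ + b)` as a coordinate, where
`t₂ = X none` and `t₁ = X (some none)`. -/
def translateEquiv (a b c : k) :
    MvPolynomial (Option (Option σ)) k ≃ₐ[k] MvPolynomial (Option (Option σ)) k :=
  AlgEquiv.ofAlgHom
    (aeval fun i => i.elim (X (some none) - C b) fun i =>
      i.elim (X none + C c * X (some none) - C a) fun i => X (some (some i)))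
    (aeval fun i => i.elim (X (some none) + C a - C c * (X none + C b)) fun i =>
      i.elim (X none + C b) fun i => X (some (some i)))
    (by
      ext i : 1
      rcases i with _ | _ | i <;> simp)
    (by
      ext i : 1
      rcases i with _ | _ | i <;> simp)

/-- The translation exhibiting `t₂ + b` and `t₁ + a` as coordinates. -/
def shiftEquiv (a b : k) :
    MvPolynomial (Option (Option σ)) k ≃ₐ[k] MvPolynomial (Option (Option σ)) k :=
  AlgEquiv.ofAlgHom
    (aeval fun i => i.elim (X none - C b) fun i =>
      i.elim (X (some none) - C a) fun i => X (some (some i)))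
    (aeval fun i => i.elim (X none + C b) fun i =>
      i.elim (X (some none) + C a) fun i => X (some (some i)))
    (by
      ext i : 1
      rcases i with _ | _ | i <;> simp)
    (by
      ext i : 1
      rcases i with _ | _ | i <;> simp)

end Coordinates

section Places

open MvPolynomial

variable {k : Type u} {K : Type*} [Field k] [Field K] [Algebra k K] {σ : Type v}
  [Algebra (MvPolynomial (Option (Option σ)) k) K]
  [IsScalarTower k (MvPolynomial (Option (Option σ)) k) K]

theorem HasLaurentLifts.isVeryGeneral [IsAlgClosed k] {d ℓ q : ℕ} (hℓ : ℓ.Prime)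
    (hd : HasTrdeg k K d)
    (ε : Fin (d - 1) ≃ Option σ) (hq : q ≠ 0) (hℓq : ¬ ℓ ∣ q)
    {Φ : Polynomial (MvPolynomial (Option (Option σ)) k)} {D : MvPolynomial (Option (Option σ)) k}
    (hlift : HasLaurentLifts.{max u v} (MvPolynomial (Option (Option σ)) k) K q Φ D)
    (hΦ : Φ.Monic) (hdeg : Φ.natDegree ≠ 0) (t₁ t₂ : K)
    (ht₁ : t₁ = algebraMap (MvPolynomial (Option (Option σ)) k) K (X (some none)))
    (ht₂ : t₂ = algebraMap (MvPolynomial (Option (Option σ)) k) K (X none)) (a b : k)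
    (y : σ → k) (hD : eval (fun i => i.elim (-b) fun i => i.elim (-a) y) D ≠ 0)
    (hgen : IsGeneralElement k ((t₁ + algebraMap k K a) / (t₂ + algebraMap k K b))) :
    IsVeryGeneral ℓ k d ((t₁ + algebraMap k K a) / (t₂ + algebraMap k K b)) := by
  have halg : ∀ c : k, algebraMap (MvPolynomial (Option (Option σ)) k) K (C c) =
      algebraMap k K c := fun c => (IsScalarTower.algebraMap_apply k _ K c).symm
  have hS : t₂ + algebraMap k K b ≠ 0 := by
    intro h
    refine hgen.1 ?_
    rw [h, div_zero]
    exact zero_mem _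
  refine isVeryGeneral_of_places hℓ hgen (fun c => ?_) ?_
  · obtain ⟨v, hv, hv1, hv0⟩ := hlift.exists_divisorial hd ε hq hℓq hΦ hdeg
      (translateEquiv a b c) (fun i => i.elim 0 fun i => i.elim 0 y) rfl (by
        convert hD using 4 with i
        rcases i with _ | _ | i <;> simp [translateEquiv])
    have hL : t₁ + algebraMap k K a - algebraMap k K c * (t₂ + algebraMap k K b) ≠ 0 := by
      intro h
      refine hgen.1 ⟨c, ?_⟩
      rw [sub_eq_zero.1 h, mul_div_cancel_right₀ _ hS]
      rfl
    have h1 := hv1 (Units.mk0 _ hL) (by simp [translateEquiv, halg, ht₁, ht₂])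
    have h0 := hv0 none (Units.mk0 _ hS) (by simp [translateEquiv, halg, ht₂])
    refine ⟨v, hv, Units.mk0 _ hL / Units.mk0 _ hS, ?_, ?_⟩
    · rw [Units.val_div_eq_div_val, Units.val_mk0, Units.val_mk0, sub_div,
        mul_div_cancel_right₀ _ hS]
    · rwa [v.v_div, h0, sub_zero]
  · obtain ⟨v, hv, hv1, hv0⟩ := hlift.exists_divisorial hd ε hq hℓq hΦ hdeg
      (shiftEquiv a b) (fun i => i.elim 0 fun i => i.elim 0 y) rfl (by
        convert hD using 4 with i
        rcases i with _ | _ | i <;> simp [shiftEquiv])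
    have hL : t₁ + algebraMap k K a ≠ 0 := by
      intro h
      refine hgen.1 ?_
      rw [h, zero_div]
      exact zero_mem _
    have h1 := hv1 (Units.mk0 _ hS) (by simp [shiftEquiv, halg, ht₂])
    have h0 := hv0 none (Units.mk0 _ hL) (by simp [shiftEquiv, halg, ht₁])
    refine ⟨v, hv, Units.mk0 _ hL / Units.mk0 _ hS, by simp, ?_⟩
    rw [v.v_div, h0, zero_sub, dvd_neg]
    exact ⟨neg_neg_of_pos h1.1, h1.2⟩

end Places

section Generality

open Polynomial

theorem IsAlgClosed.mem_range_algebraMap_of_isIntegral {k L : Type*} [Field k] [IsAlgClosed k]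
    [Field L] [Algebra k L] {x : L} (hx : IsIntegral k x) : x ∈ (algebraMap k L).range :=
  minpoly.mem_range_of_degree_eq_one k x
    (IsAlgClosed.degree_eq_one_of_irreducible k (minpoly.irreducible hx))

/-- A polynomial over an extension of the infinite field `k` which takes values in `k` on `k` has
coefficients in `k`. -/
theorem Polynomial.exists_map_eq_of_eval_mem_range {k L : Type*} [Field k] [Infinite k] [Field L]
    [Algebra k L] (f : L[X])
    (hf : ∀ c : k, f.eval (algebraMap k L c) ∈ (algebraMap k L).range) :
    ∃ g : k[X], g.map (algebraMap k L) = f := by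
  classical
  choose r hr using hf
  obtain ⟨s, hs⟩ := Infinite.exists_subset_card_eq k (f.natDegree + 1)
  have hinj : Function.Injective (algebraMap k L) := (algebraMap k L).injective
  have hcard : (s.image (algebraMap k L)).card = f.natDegree + 1 := by
    rw [Finset.card_image_of_injective s hinj, hs]
  refine ⟨Lagrange.interpolate s id r, eq_of_degrees_lt_of_eval_finset_eq
    (s.image (algebraMap k L)) ?_ ?_ ?_⟩
  · rw [hcard, ← hs]
    exact degree_map_le.trans_lt (Lagrange.degree_interpolate_lt r Function.injective_id.injOn)
  · rw [hcard]
    exact degree_le_natDegree.trans_lt (by exact_mod_cast Nat.lt_succ_self _)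
  · intro x hx
    obtain ⟨c, hc, rfl⟩ := Finset.mem_image.1 hx
    rw [eval_map_algebraMap, aeval_algebraMap_apply, ← hr c, aeval_def, Algebra.algebraMap_self,
      eval₂_id]
    exact congrArg _ (Lagrange.eval_interpolate_at_node r Function.injective_id.injOn hc)

/-- `k(X)` is algebraically closed in `L(X)` if `k` is algebraically closed. -/
theorem exists_mul_eq_of_isAlgebraic_polynomial {k L E : Type*} [Field k] [IsAlgClosed k] [Field L]
    [Algebra k L] [Field E] [Algebra L[X] E] [IsFractionRing L[X] E] [Algebra k[X] E]
    (hG : ∀ f : k[X], algebraMap k[X] E f = algebraMap L[X] E (f.map (algebraMap k L)))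
    {α : E} (hα : IsAlgebraic k[X] α) :
    ∃ f g : k[X], g ≠ 0 ∧ algebraMap k[X] E g * α = algebraMap k[X] E f := by
  obtain ⟨g, hg, H, hH, hH0⟩ := hα.exists_integral_multiple
  have hGc : algebraMap k[X] E = (algebraMap L[X] E).comp (mapRingHom (algebraMap k L)) :=
    RingHom.ext hG
  rw [Algebra.smul_def] at hH0
  obtain ⟨F, hF⟩ := (IsIntegrallyClosed.isIntegral_iff (R := L[X])
    (x := algebraMap k[X] E g * α)).1 ⟨H.map (mapRingHom (algebraMap k L)), hH.map _, by
      rwa [eval₂_map, ← hGc]⟩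
  have hF0 : H.eval₂ (mapRingHom (algebraMap k L)) F = 0 := by
    refine IsFractionRing.injective L[X] E ?_
    rw [hom_eval₂, ← hGc, hF, hH0, map_zero]
  obtain ⟨f, hf⟩ := Polynomial.exists_map_eq_of_eval_mem_range F fun c => by
    refine IsAlgClosed.mem_range_algebraMap_of_isIntegral ⟨H.map (evalRingHom c), hH.map _, ?_⟩
    have := congrArg (evalRingHom (algebraMap k L c)) hF0
    rw [hom_eval₂, map_zero] at this
    rw [eval₂_map]
    convert this using 1
    congr 1
    refine Polynomial.ringHom_ext (fun a => ?_) ?_ <;> simp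
  exact ⟨f, g, hg, by rw [hG f, hf, hF]⟩

/-- In characteristic `p`, if `t` is not a `p`-th power then the `p`-th powers in `k[t]` are the
`p`-th powers of elements of `k[t]`. -/
theorem exists_aeval_eq_of_pow_eq_aeval {k K : Type*} [Field k] [Field K] [Algebra k K]
    (p : ℕ) [Fact p.Prime] [CharP k p] [PerfectRing k p] {t : K}
    (htr : Function.Injective (aeval t : k[X] →ₐ[k] K)) (ht : ∀ z : K, z ^ p ≠ t) {y : K} {P : k[X]}
    (hy : y ^ p = aeval t P) : ∃ Q : k[X], y = aeval t Q := by
  have hp := Fact.out (p := p.Prime)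
  have : CharP K p := charP_of_injective_algebraMap (algebraMap k K).injective p
  let M : Subfield K := (frobenius K p).fieldRange
  have hM : ∀ z : K, z ^ p ∈ M := fun z => ⟨z, rfl⟩
  have hkM : ∀ c : k, algebraMap k K c ∈ M := by
    intro c
    refine ⟨algebraMap k K ((frobeniusEquiv k p).symm c), ?_⟩
    rw [frobenius_def, ← map_pow, ← frobenius_def, frobenius_apply_frobeniusEquiv_symm]
  let i : k →+* M := (algebraMap k K).codRestrict M hkM
  have hirr : Irreducible (X ^ p - C (⟨t ^ p, hM t⟩ : M)) := by
    refine X_pow_sub_C_irreducible_of_prime hp fun b hb => ?_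
    have : (b : K) = t := frobenius_inj K p (congrArg Subtype.val hb)
    obtain ⟨z, hz⟩ := b.2
    exact ht z (by rw [← this, ← hz]; rfl)
  have hmin := minpoly.eq_of_irreducible_of_monic hirr (x := t) (by
    rw [map_sub, map_pow, aeval_X, aeval_C, sub_eq_zero]; rfl) (monic_X_pow_sub_C _ hp.ne_zero)
  have hPM : aeval t (P.map i) = aeval t P := by
    rw [aeval_def, eval₂_map]
    rfl
  obtain ⟨U, hU⟩ := hmin ▸ minpoly.dvd M t (p := P.map i - C (⟨y ^ p, hM y⟩ : M)) (by
    rw [map_sub, hPM, aeval_C, sub_eq_zero, ← hy]; rfl)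
  have hder : aeval t (derivative P) = 0 := by
    have h1 := congrArg (fun q => aeval t (derivative q)) hU
    have h2 : aeval t (X ^ p - C (⟨t ^ p, hM t⟩ : M)) = 0 := by
      rw [map_sub, map_pow, aeval_X, aeval_C, sub_eq_zero]; rfl
    have h3 : derivative (X ^ p - C (⟨t ^ p, hM t⟩ : M)) = 0 := by
      simp [derivative_X_pow]
    simp only [derivative_sub, derivative_C, sub_zero, derivative_mul, h3, zero_mul, zero_add,
      map_mul, h2, derivative_map] at h1
    rw [← h1, aeval_def, aeval_def, eval₂_map]
    rfl
  have hder0 : derivative P = 0 := htr (by rw [hder, map_zero])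
  have hexp := expand_contract p hder0 hp.ne_zero
  refine ⟨(contract p P).map (frobeniusEquiv k p).symm.toRingHom, frobenius_inj K p ?_⟩
  rw [frobenius_def, frobenius_def, hy, ← map_pow, ← map_frobenius_expand p, map_expand.symm,
    map_map]
  congr 1
  conv_lhs => rw [← hexp]
  rw [map_expand]
  congr 1
  conv_lhs => rw [← Polynomial.map_id (p := contract p P)]
  congr 1
  ext c
  simp

/-- In characteristic exponent `p`, if `t` is not a `p`-th power then `k(t)` is closed under
extraction of `p`-power roots. -/
theorem mem_adjoin_of_pow_mem {k K : Type*} [Field k] [Field K] [Algebra k K]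
    (p : ℕ) [Fact p.Prime] [CharP k p] [PerfectRing k p] {t : K}
    (htr : Function.Injective (aeval t : k[X] →ₐ[k] K)) (ht : ∀ z : K, z ^ p ≠ t) (n : ℕ) {x : K}
    (hx : x ^ p ^ n ∈ IntermediateField.adjoin k {t}) : x ∈ IntermediateField.adjoin k {t} := by
  induction n with
  | zero => simpa using hx
  | succ n ih =>
    refine ih ?_
    rw [pow_succ, pow_mul] at hx
    obtain ⟨r, s, hrs⟩ := (IntermediateField.mem_adjoin_simple_iff k _).1 hx
    have hp := (Fact.out (p := p.Prime))
    by_cases hs : aeval t s = 0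
    · rw [hs, div_zero] at hrs
      rw [eq_zero_of_pow_eq_zero hrs]
      exact zero_mem _
    · obtain ⟨Q, hQ⟩ := exists_aeval_eq_of_pow_eq_aeval p htr ht (y := x ^ p ^ n * aeval t s)
        (P := r * s ^ (p - 1)) (by
          rw [mul_pow, hrs, map_mul, map_pow]
          obtain ⟨m, hm⟩ := Nat.exists_eq_succ_of_ne_zero hp.ne_zero
          rw [hm]
          simp only [Nat.succ_eq_add_one, Nat.add_sub_cancel]
          field_simp
          ring)
      exact (IntermediateField.mem_adjoin_simple_iff k _).2 ⟨Q, s, (eq_div_iff hs).2 hQ⟩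

theorem isGeneralElement_of_laurent {k K : Type*} [Field k] [IsAlgClosed k] [Field K] [Algebra k K]
    (p n : ℕ) [ExpChar k p] {L E : Type*} [Field L] [Algebra k L] [Field E] [Algebra L[X] E]
    [IsFractionRing L[X] E] (Ψ : K →+* LaurentSeries E) (t : K)
    (hΨc : ∀ c : k, Ψ (algebraMap k K c) =
      HahnSeries.C (algebraMap L[X] E (C (algebraMap k L c))) ^ p ^ n)
    (hΨt : Ψ t = HahnSeries.C (algebraMap L[X] E X) ^ p ^ n)
    (ht : p ≠ 1 → ∀ z : K, z ^ p ≠ t) : IsGeneralElement k t := by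
  let G : k[X] →+* E := (algebraMap L[X] E).comp (mapRingHom (algebraMap k L))
  have hGinj : Function.Injective G := (IsFractionRing.injective L[X] E).comp
    (map_injective _ (algebraMap k L).injective)
  have hq : 0 < p ^ n := pow_pos (expChar_pos k p) n
  let κ : k[X] →+* K := (aeval t : k[X] →ₐ[k] K).toRingHom
  have hΨκ : Ψ.comp κ = ((HahnSeries.C : E →+* LaurentSeries E).comp G).comp
      (iterateFrobenius k[X] p n) := by
    refine Polynomial.ringHom_ext (fun c => ?_) ?_
    · simp only [RingHom.comp_apply, κ, G, iterateFrobenius_def, map_pow, AlgHom.toRingHom_eq_coe,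
        RingHom.coe_coe, aeval_C, hΨc, coe_mapRingHom, map_C]
    · simp only [RingHom.comp_apply, κ, G, iterateFrobenius_def, map_pow, AlgHom.toRingHom_eq_coe,
        RingHom.coe_coe, aeval_X, hΨt, coe_mapRingHom, map_X]
  have hΨκ' : ∀ f : k[X], Ψ (aeval t f) = HahnSeries.C (G f) ^ p ^ n := by
    intro f
    have := RingHom.congr_fun hΨκ f
    simp only [RingHom.comp_apply, iterateFrobenius_def, map_pow] at this
    exact this
  have hCinj : Function.Injective (HahnSeries.C : E →+* LaurentSeries E) := RingHom.injective _
  have hFinj : Function.Injective (iterateFrobenius k[X] p n) := iterateFrobenius_inj _ _ _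
  have htr : Function.Injective (aeval t : k[X] →ₐ[k] K) := by
    have h1 : Function.Injective (Ψ.comp κ) := by
      rw [hΨκ]
      exact (hCinj.comp hGinj).comp hFinj
    exact Function.Injective.of_comp h1
  refine ⟨?_, fun x hx => ?_⟩
  · rintro ⟨c, hc⟩
    have : (X - C c : k[X]) = 0 := htr (by
      rw [map_sub, aeval_X, aeval_C, map_zero, sub_eq_zero]; exact hc.symm)
    exact X_sub_C_ne_zero c this
  rw [IntermediateField.isAlgebraic_adjoin_iff] at hx
  let _ : Algebra k[X] K := κ.toAlgebra
  let _ : Algebra k[X] E := G.toAlgebra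
  have hCalg : algebraMap k[X] (LaurentSeries E) = (HahnSeries.C : E →+* LaurentSeries E).comp G :=
    RingHom.ext fun f => by
      rw [HahnSeries.algebraMap_apply', RingHom.comp_apply, ← HahnSeries.ofPowerSeries_C,
        PowerSeries.algebraMap_apply]
      rfl
  have hx1 : IsAlgebraic k[X] x := by
    refine IsAlgebraic.of_ringHom_of_comp_eq (S := Algebra.adjoin k {t})
      ((aeval t : k[X] →ₐ[k] K).codRestrict (Algebra.adjoin k {t}) fun f => ?_) (RingHom.id K) hx
      ?_ Function.injective_id rfl
    · exact aeval_mem_adjoin_singleton k t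
    · rintro ⟨z, hz⟩
      rw [Algebra.adjoin_singleton_eq_range_aeval] at hz
      obtain ⟨f, rfl⟩ := hz
      exact ⟨f, rfl⟩
  have hx2 : IsAlgebraic k[X] (Ψ x) :=
    hx1.ringHom_of_comp_eq (iterateFrobenius k[X] p n) Ψ hFinj (by rw [hCalg]; exact hΨκ.symm)
  have hx3 : IsAlgebraic E (Ψ x) := by
    refine hx2.ringHom_of_comp_eq G (RingHom.id _) hGinj ?_
    rw [hCalg]
    refine RingHom.ext fun f => ?_
    change algebraMap E (LaurentSeries E) (G f) = HahnSeries.C (G f)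
    rw [HahnSeries.algebraMap_apply', ← HahnSeries.ofPowerSeries_C]
    rfl
  obtain ⟨α, hα⟩ := LaurentSeries.exists_eq_C_of_isAlgebraic _ hx3
  rw [hα] at hx2
  have hα1 : IsAlgebraic k[X] α :=
    hx2.of_ringHom_of_comp_eq (RingHom.id k[X]) (HahnSeries.C : E →+* LaurentSeries E)
      Function.surjective_id hCinj (by rw [hCalg]; rfl)
  obtain ⟨f, g, hg, hfg⟩ := exists_mul_eq_of_isAlgebraic_polynomial (fun f => rfl) hα1
  have hxf : aeval t g * x ^ p ^ n = aeval t f := by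
    apply Ψ.injective
    rw [map_mul, map_pow, hΨκ', hΨκ', hα, ← mul_pow, ← map_mul]
    exact congrArg (fun z => HahnSeries.C z ^ p ^ n) hfg
  have hg0 : aeval t g ≠ 0 := by rwa [Ne, map_eq_zero_iff _ htr]
  have hxq : x ^ p ^ n ∈ IntermediateField.adjoin k {t} :=
    (IntermediateField.mem_adjoin_simple_iff k _).2 ⟨f, g, by
      rw [eq_div_iff hg0, mul_comm, hxf]⟩
  cases ‹ExpChar k p› with
  | zero => simpa using hxq
  | prime hp =>
    have : Fact p.Prime := ⟨hp⟩
    exact mem_adjoin_of_pow_mem p htr (ht hp.ne_one) n hxq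

end Generality

section BlowUp

open MvPolynomial

/-- The substitution `t₁ ↦ t₁ t₂`, where `t₂ = X none` and `t₁ = X (some none)`. -/
def blowUpHom (k σ : Type*) [Field k] :
    MvPolynomial (Option (Option σ)) k →ₐ[k] MvPolynomial (Option (Option σ)) k :=
  aeval fun i => i.elim (X none) fun i => i.elim (X (some none) * X none) fun i => X (some (some i))

theorem blowUpHom_injective (k σ : Type*) [Field k] : Function.Injective (blowUpHom k σ) := by
  let γ : MvPolynomial (Option (Option σ)) k →ₐ[k]
      FractionRing (MvPolynomial (Option (Option σ)) k) :=
    aeval fun i => i.elim (algebraMap (MvPolynomial (Option (Option σ)) k) _ (X none)) fun i =>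
      i.elim (algebraMap (MvPolynomial (Option (Option σ)) k) _ (X (some none)) /
          algebraMap (MvPolynomial (Option (Option σ)) k) _ (X none)) fun i =>
        algebraMap (MvPolynomial (Option (Option σ)) k) _ (X (some (some i)))
  have hne : algebraMap (MvPolynomial (Option (Option σ)) k)
      (FractionRing (MvPolynomial (Option (Option σ)) k)) (X none) ≠ 0 := by
    rw [Ne, IsFractionRing.to_map_eq_zero_iff]
    exact X_ne_zero _
  have hγ : γ.comp (blowUpHom k σ) = IsScalarTower.toAlgHom k (MvPolynomial (Option (Option σ)) k)
      (FractionRing (MvPolynomial (Option (Option σ)) k)) := by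
    ext i
    rcases i with _ | _ | i <;> simp [γ, blowUpHom, hne]
  have hinj : Function.Injective (γ.comp (blowUpHom k σ)) := by
    rw [hγ]
    exact IsFractionRing.injective _ _
  exact fun x y h => hinj (congrArg γ h)

variable {k σ : Type*} [Field k]

/-- The chart of the blow-up at the point `t₁ = -a`, `t₂ = -b` in which `(t₁ + a) / (t₂ + b)` is a
coordinate. -/
def blowUpChart (a b : k) :
    MvPolynomial (Option (Option σ)) k →ₐ[k] MvPolynomial (Option (Option σ)) k :=
  (blowUpHom k σ).comp (shiftEquiv a b).toAlgHom

theorem blowUpChart_injective (a b : k) : Function.Injective (blowUpChart (σ := σ) a b) :=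
  (blowUpHom_injective k σ).comp (shiftEquiv a b).injective

theorem blowUpChart_C (a b c : k) : blowUpChart (σ := σ) a b (C c) = C c :=
  (blowUpChart a b).commutes c

theorem blowUpChart_X_none (a b : k) : blowUpChart (σ := σ) a b (X none) = X none - C b := by
  simp [blowUpChart, blowUpHom, shiftEquiv]

theorem blowUpChart_X_some_none (a b : k) :
    blowUpChart (σ := σ) a b (X (some none)) = X (some none) * X none - C a := by
  simp [blowUpChart, blowUpHom, shiftEquiv]

theorem blowUpChart_X_some_some (a b : k) (i : σ) :
    blowUpChart a b (X (some (some i))) = X (some (some i)) := by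
  simp [blowUpChart, blowUpHom, shiftEquiv]

theorem eval_blowUpChart (a b : k) (y : σ → k) (Q : MvPolynomial (Option (Option σ)) k) :
    eval (fun i => i.elim 0 fun i => i.elim 0 y) (blowUpChart a b Q) =
      eval (fun i => i.elim (-b) fun i => i.elim (-a) y) Q := by
  have : (eval fun i : Option (Option σ) => i.elim 0 fun i => i.elim 0 y).comp
      (blowUpChart a b).toRingHom =
      eval fun i : Option (Option σ) => i.elim (-b) fun i => i.elim (-a) y := by
    refine MvPolynomial.ringHom_ext (fun c => ?_) fun i => ?_
    · simp
    · rcases i with _ | _ | i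
      · simp [blowUpChart_X_none]
      · simp [blowUpChart_X_some_none]
      · simp [blowUpChart_X_some_some]
  exact RingHom.congr_fun this Q

variable {L : Type*} [Field L] (E : Type*) [Field E] [Algebra (Polynomial L) E]

/-- The embedding of `k[X₀, Xᵢ : i ∈ σ]` into a field extension of `L[X]` with `X₀ ↦ X`. -/
def rationalHom (ι : MvPolynomial σ k →+* L) : MvPolynomial (Option σ) k →+* E :=
  ((algebraMap (Polynomial L) E).comp (Polynomial.mapRingHom ι)).comp
    (optionEquivLeft k σ).toRingEquiv.toRingHom

theorem rationalHom_injective [IsFractionRing (Polynomial L) E] {ι : MvPolynomial σ k →+* L}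
    (hι : Function.Injective ι) : Function.Injective (rationalHom E ι) :=
  ((IsFractionRing.injective (Polynomial L) E).comp (Polynomial.map_injective ι hι)).comp
    (optionEquivLeft k σ).injective

theorem seriesHom_rationalHom_C (ι : MvPolynomial σ k →+* L) (c : k) :
    seriesHom (rationalHom E ι) (C c) =
      PowerSeries.C (algebraMap (Polynomial L) E (Polynomial.C (ι (C c)))) := by
  simp [seriesHom, rationalHom]

theorem seriesHom_rationalHom_X_some_none (ι : MvPolynomial σ k →+* L) :
    seriesHom (rationalHom E ι) (X (some none)) =
      PowerSeries.C (algebraMap (Polynomial L) E Polynomial.X) := by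
  simp [seriesHom, rationalHom]

theorem seriesHom_rationalHom_X_some_some (ι : MvPolynomial σ k →+* L) (i : σ) :
    seriesHom (rationalHom E ι) (X (some (some i))) =
      PowerSeries.C (algebraMap (Polynomial L) E (Polynomial.C (ι (X i)))) := by
  simp [seriesHom, rationalHom]

/-- The expansion along the exceptional divisor of the blow-up at `t₁ = -a`, `t₂ = -b`. -/
def blowUpSeries (ι : MvPolynomial σ k →+* L) (a b : k) :
    MvPolynomial (Option (Option σ)) k →+* PowerSeries E :=
  (seriesHom (rationalHom E ι)).comp (blowUpChart a b).toRingHom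

theorem blowUpSeries_apply (ι : MvPolynomial σ k →+* L) (a b : k)
    (Q : MvPolynomial (Option (Option σ)) k) :
    blowUpSeries E ι a b Q = seriesHom (rationalHom E ι) (blowUpChart a b Q) :=
  rfl

theorem blowUpSeries_injective [IsFractionRing (Polynomial L) E] {ι : MvPolynomial σ k →+* L}
    (hι : Function.Injective ι) (a b : k) : Function.Injective (blowUpSeries E ι a b) := by
  intro Q Q' h
  rw [blowUpSeries_apply, blowUpSeries_apply] at h
  exact blowUpChart_injective a b (seriesHom_injective (rationalHom_injective E hι) h)

theorem constantCoeff_comp_blowUpSeries (ι : MvPolynomial σ k →+* L) (a b : k) :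
    PowerSeries.constantCoeff.comp (blowUpSeries E ι a b) =
      ((algebraMap (Polynomial L) E).comp Polynomial.C).comp (ι.comp
        (aeval fun i : Option (Option σ) => i.elim (C (-b)) fun i => i.elim (C (-a)) X :
          _ →ₐ[k] MvPolynomial σ k).toRingHom) := by
  refine MvPolynomial.ringHom_ext (fun c => ?_) fun i => ?_
  · simp [blowUpSeries_apply, seriesHom_rationalHom_C]
  · rcases i with _ | _ | i
    · simp [blowUpSeries_apply, blowUpChart_X_none, seriesHom_rationalHom_C, seriesHom_X_none]
    · simp [blowUpSeries_apply, blowUpChart_X_some_none, seriesHom_rationalHom_C, seriesHom_X_none]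
    · simp [blowUpSeries_apply, blowUpChart_X_some_some, seriesHom_rationalHom_X_some_some]

end BlowUp

section General

open MvPolynomial

theorem HasLaurentLifts.isGeneralElement_of_embedding {k K σ : Type*} [Field k] [Field K]
    [Algebra k K] [Algebra (MvPolynomial (Option (Option σ)) k) K]
    [IsScalarTower k (MvPolynomial (Option (Option σ)) k) K] [IsAlgClosed k] {p n : ℕ} [ExpChar k p]
    {L : Type*} [Field L] [IsAlgClosed L] [Algebra k L] {E : Type w} [Field E]
    [Algebra (Polynomial L) E] [IsFractionRing (Polynomial L) E]
    {ι : MvPolynomial σ k →+* L} (hι : Function.Injective ι)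
    (hιC : ∀ c : k, algebraMap k L c = ι (C c))
    {Φ : Polynomial (MvPolynomial (Option (Option σ)) k)} {D : MvPolynomial (Option (Option σ)) k}
    (hlift : HasLaurentLifts.{w} (MvPolynomial (Option (Option σ)) k) K (p ^ n) Φ D)
    (hΦ : Φ.Monic) (hdeg : Φ.natDegree ≠ 0) {t₁ t₂ : K}
    (ht₁ : t₁ = algebraMap (MvPolynomial (Option (Option σ)) k) K (X (some none)))
    (ht₂ : t₂ = algebraMap (MvPolynomial (Option (Option σ)) k) K (X none)) (a b : k)
    (y : σ → k) (hD : eval (fun i => i.elim (-b) fun i => i.elim (-a) y) D ≠ 0)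
    (ht : p ≠ 1 → ∀ z : K, z ^ p ≠ (t₁ + algebraMap k K a) / (t₂ + algebraMap k K b)) :
    IsGeneralElement k ((t₁ + algebraMap k K a) / (t₂ + algebraMap k K b)) := by
  obtain ⟨r, hr⟩ := exists_eval₂_eq_zero_of_monic hΦ hdeg (ι.comp
    (aeval fun i : Option (Option σ) => i.elim (C (-b)) fun i => i.elim (C (-a)) X :
      _ →ₐ[k] MvPolynomial σ k).toRingHom)
  have hDA : PowerSeries.constantCoeff (blowUpSeries E ι a b D) ≠ 0 := by
    rw [blowUpSeries_apply]
    refine constantCoeff_seriesHom_ne_zero (rationalHom_injective E hι)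
      (P := fun i => i.elim 0 fun i => i.elim 0 y) rfl ?_
    rwa [eval_blowUpChart]
  have hroot : ∃ r : E,
      Φ.eval₂ (PowerSeries.constantCoeff.comp (blowUpSeries E ι a b)) r = 0 := by
    refine ⟨algebraMap (Polynomial L) E (Polynomial.C r), ?_⟩
    rw [constantCoeff_comp_blowUpSeries, ← RingHom.comp_apply (algebraMap (Polynomial L) E),
      ← Polynomial.hom_eval₂, hr, map_zero]
  obtain ⟨Ψ, hΨ⟩ := hlift E (blowUpSeries E ι a b) (blowUpSeries_injective E hι a b) hroot hDA
  have halg : ∀ c : k, algebraMap k K c = algebraMap (MvPolynomial (Option (Option σ)) k) K (C c) :=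
    fun c => IsScalarTower.algebraMap_apply k _ K c
  have h1 : Ψ (t₁ + algebraMap k K a) = (HahnSeries.C (algebraMap (Polynomial L) E Polynomial.X) *
      HahnSeries.ofPowerSeries ℤ E PowerSeries.X) ^ p ^ n := by
    rw [ht₁, halg, ← map_add, hΨ, blowUpSeries_apply, map_add, blowUpChart_X_some_none, blowUpChart_C,
      sub_add_cancel, map_mul, seriesHom_rationalHom_X_some_none, seriesHom_X_none, map_mul,
      HahnSeries.ofPowerSeries_C]
  have h2 : Ψ (t₂ + algebraMap k K b) = HahnSeries.ofPowerSeries ℤ E PowerSeries.X ^ p ^ n := by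
    rw [ht₂, halg, ← map_add, hΨ, blowUpSeries_apply, map_add, blowUpChart_X_none, blowUpChart_C, sub_add_cancel,
      seriesHom_X_none]
  have hX : (HahnSeries.ofPowerSeries ℤ E PowerSeries.X : LaurentSeries E) ≠ 0 := by
    rw [HahnSeries.ofPowerSeries_X]
    simp
  refine isGeneralElement_of_laurent p n (L := L) (E := E) Ψ _ (fun c => ?_) ?_ ht
  · rw [halg, hΨ, hιC, blowUpSeries_apply, blowUpChart_C, seriesHom_rationalHom_C, HahnSeries.ofPowerSeries_C]
  · rw [map_div₀, h1, h2, ← div_pow, mul_div_cancel_right₀ _ hX]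

theorem HasLaurentLifts.isGeneralElement {k : Type u} {K : Type*} {σ : Type v} [Field k] [Field K]
    [Algebra k K] [Algebra (MvPolynomial (Option (Option σ)) k) K]
    [IsScalarTower k (MvPolynomial (Option (Option σ)) k) K] [IsAlgClosed k] {p n : ℕ} [ExpChar k p]
    {Φ : Polynomial (MvPolynomial (Option (Option σ)) k)} {D : MvPolynomial (Option (Option σ)) k}
    (hlift : HasLaurentLifts.{max u v} (MvPolynomial (Option (Option σ)) k) K (p ^ n) Φ D)
    (hΦ : Φ.Monic) (hdeg : Φ.natDegree ≠ 0) {t₁ t₂ : K}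
    (ht₁ : t₁ = algebraMap (MvPolynomial (Option (Option σ)) k) K (X (some none)))
    (ht₂ : t₂ = algebraMap (MvPolynomial (Option (Option σ)) k) K (X none)) (a b : k)
    (y : σ → k) (hD : eval (fun i => i.elim (-b) fun i => i.elim (-a) y) D ≠ 0)
    (ht : p ≠ 1 → ∀ z : K, z ^ p ≠ (t₁ + algebraMap k K a) / (t₂ + algebraMap k K b)) :
    IsGeneralElement k ((t₁ + algebraMap k K a) / (t₂ + algebraMap k K b)) := by
  refine isGeneralElement_of_embedding
    (L := AlgebraicClosure (FractionRing (MvPolynomial σ k)))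
    (E := FractionRing (Polynomial (AlgebraicClosure (FractionRing (MvPolynomial σ k)))))
    (ι := (algebraMap (FractionRing (MvPolynomial σ k))
      (AlgebraicClosure (FractionRing (MvPolynomial σ k)))).comp (algebraMap _ _))
    (by
      rw [RingHom.coe_comp]
      exact (RingHom.injective _).comp (IsFractionRing.injective _ _)) (fun c => ?_) hlift hΦ hdeg ht₁ ht₂ a b y hD ht
  rw [IsScalarTower.algebraMap_apply k (FractionRing (MvPolynomial σ k)),
    IsScalarTower.algebraMap_apply k (MvPolynomial σ k) (FractionRing (MvPolynomial σ k))]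
  rfl

end General

section Assembly

open MvPolynomial

theorem exists_isTranscendenceBasis_option {k : Type u} {K : Type v} [Field k] [Field K]
    [Algebra k K] {t₁ t₂ : K} (hind : AlgebraicIndependent k ![t₁, t₂]) :
    ∃ (σ : Type v) (z : Option (Option σ) → K), IsTranscendenceBasis k z ∧
      z (some none) = t₁ ∧ z none = t₂ := by
  classical
  obtain ⟨s, hs, hbasis⟩ := exists_isTranscendenceBasis_superset hind.to_subtype_range
  have h₁ : t₁ ∈ s := hs ⟨0, rfl⟩
  have h₂ : t₂ ∈ s := hs ⟨1, rfl⟩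
  have hne : t₁ ≠ t₂ := fun h => absurd (hind.injective (a₁ := 0) (a₂ := 1) h) (by decide)
  let x₂ : s := ⟨t₂, h₂⟩
  let x₁ : {x : s // x ≠ x₂} := ⟨⟨t₁, h₁⟩, fun h => hne (congrArg Subtype.val h)⟩
  let e : Option (Option {y : {x : s // x ≠ x₂} // y ≠ x₁}) ≃ s :=
    (Equiv.optionCongr (Equiv.optionSubtypeNe x₁)).trans (Equiv.optionSubtypeNe x₂)
  exact ⟨_, Subtype.val ∘ e, (isTranscendenceBasis_equiv e).2 hbasis, by simp [e, x₁],
    by simp [e, x₂]⟩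

theorem IsTranscendenceBasis.exists_equiv_of_option {k K τ : Type*} [Field k] [Field K]
    [Algebra k K] {z : Option τ → K} (hz : IsTranscendenceBasis k z) {d : ℕ}
    (hd : HasTrdeg k K d) : Nonempty (Fin (d - 1) ≃ τ) := by
  obtain ⟨x, hx⟩ := hd
  obtain ⟨e⟩ := Cardinal.lift_mk_eq'.1 (hx.lift_cardinalMk_eq hz)
  obtain ⟨m, rfl⟩ : ∃ m, d = m + 1 :=
    Nat.exists_eq_succ_of_ne_zero fun h => by subst h; exact (e.symm none).elim0
  exact ⟨((finSuccEquiv m).symm.trans e).removeNone⟩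

theorem exists_hasLaurentLifts {k K τ : Type*} [Field k] [Field K] [Algebra k K]
    [Algebra (MvPolynomial τ k) K] [IsScalarTower k (MvPolynomial τ k) K]
    (hK : IsFunctionField k K)
    (hz : IsTranscendenceBasis k fun i => algebraMap (MvPolynomial τ k) K (X i))
    (p : ℕ) [ExpChar k p] :
    ∃ (n : ℕ) (Φ : Polynomial (MvPolynomial τ k)) (D : MvPolynomial τ k), Φ.Monic ∧
      Φ.natDegree ≠ 0 ∧ D ≠ 0 ∧ HasLaurentLifts.{w} (MvPolynomial τ k) K (p ^ n) Φ D := by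
  have hmap : (aeval fun i => algebraMap (MvPolynomial τ k) K (X i)) =
      IsScalarTower.toAlgHom k (MvPolynomial τ k) K := by
    ext i
    simp
  have hinj : Function.Injective (algebraMap (MvPolynomial τ k) K) := by
    have : Function.Injective (aeval (R := k) fun i => algebraMap (MvPolynomial τ k) K (X i)) :=
      hz.1
    rwa [hmap] at this
  have : FaithfulSMul (MvPolynomial τ k) K := (faithfulSMul_iff_algebraMap_injective _ _).2 hinj
  let _ : Algebra (FractionRing (MvPolynomial τ k)) K := FractionRing.liftAlgebra _ K
  have : IsScalarTower (MvPolynomial τ k) (FractionRing (MvPolynomial τ k)) K :=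
    FractionRing.isScalarTower_liftAlgebra _ K
  have : IsScalarTower k (FractionRing (MvPolynomial τ k)) K :=
    IsScalarTower.to₁₃₄ _ (MvPolynomial τ k) _ _
  have halg : ∀ x : K, IsAlgebraic (FractionRing (MvPolynomial τ k)) x := by
    intro x
    refine (IsFractionRing.isAlgebraic_iff (MvPolynomial τ k) _ K).1 ?_
    have hx := hz.isAlgebraic.isAlgebraic x
    refine hx.of_ringHom_of_comp_eq
      (((aeval fun i => algebraMap (MvPolynomial τ k) K (X i)).codRestrict
        (Algebra.adjoin k (Set.range fun i => algebraMap (MvPolynomial τ k) K (X i)))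
        fun f => by
          rw [Algebra.adjoin_range_eq_range_aeval]
          exact ⟨f, rfl⟩).toRingHom) (RingHom.id K) ?_
      Function.injective_id ?_
    · rintro ⟨y, hy⟩
      rw [Algebra.adjoin_range_eq_range_aeval] at hy
      obtain ⟨f, rfl⟩ := hy
      exact ⟨f, rfl⟩
    · exact congrArg AlgHom.toRingHom hmap
  obtain ⟨s, hs⟩ := hK
  have hs' : IntermediateField.adjoin (FractionRing (MvPolynomial τ k)) (s : Set K) = ⊤ :=
    IntermediateField.adjoin_eq_top_of_adjoin_eq_top k hs
  have : FiniteDimensional (FractionRing (MvPolynomial τ k)) K := by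
    have := IntermediateField.finiteDimensional_adjoin
      (K := FractionRing (MvPolynomial τ k)) (S := (s : Set K)) fun x _ => (halg x).isIntegral
    rw [hs'] at this
    exact IntermediateField.topEquiv.toLinearEquiv.finiteDimensional
  have : ExpChar (FractionRing (MvPolynomial τ k)) p :=
    expChar_of_injective_algebraMap (algebraMap k _).injective p
  exact exists_laurent_lift (MvPolynomial τ k) (FractionRing (MvPolynomial τ k)) K p

theorem Polynomial.eval_mvPolynomial_aeval {k σ : Type*} [CommRing k] (f : σ → Polynomial k)
    (D : MvPolynomial σ k) (a : k) :
    (MvPolynomial.aeval f D).eval a = MvPolynomial.eval (fun i => (f i).eval a) D := by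
  have : (Polynomial.evalRingHom a).comp (MvPolynomial.aeval f).toRingHom =
      MvPolynomial.eval fun i => (f i).eval a :=
    MvPolynomial.ringHom_ext (fun c => by simp) fun i => by simp
  exact RingHom.congr_fun this D

/-- A nonzero polynomial does not vanish at a sufficiently general point of a suitable plane. -/
theorem MvPolynomial.exists_finite_zeros_of_plane {k σ : Type*} [Field k] [Infinite k]
    {D : MvPolynomial (Option (Option σ)) k} (hD : D ≠ 0) :
    ∃ y : σ → k, {b : k | ¬ {a : k |
      eval (fun i => i.elim (-b) fun i => i.elim (-a) y) D = 0}.Finite}.Finite := by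
  obtain ⟨P, hP⟩ : ∃ P, eval P D ≠ 0 := by
    by_contra! h
    exact hD (MvPolynomial.funext fun P => by rw [h, map_zero])
  let y : σ → k := fun i => P (some (some i))
  let g : Polynomial k := aeval (fun i => i.elim (-Polynomial.X) fun i =>
    i.elim (Polynomial.C (P (some none))) fun i => Polynomial.C (y i)) D
  have hg : ∀ b, g.eval b = eval (fun i => i.elim (-b) fun i => i.elim (P (some none)) y) D := by
    intro b
    rw [Polynomial.eval_mvPolynomial_aeval]
    congr 2
    funext i
    rcases i with _ | _ | i <;> simp
  have hg0 : g ≠ 0 := by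
    intro h
    apply hP
    have := hg (-P none)
    rw [h, Polynomial.eval_zero] at this
    rw [this]
    congr 2
    funext i
    rcases i with _ | _ | i <;> simp [y]
  refine ⟨y, (Polynomial.finite_setOfPred_isRoot hg0).subset fun b hb => ?_⟩
  let h : Polynomial k := aeval (fun i => i.elim (Polynomial.C (-b)) fun i =>
    i.elim (-Polynomial.X) fun i => Polynomial.C (y i)) D
  have hh : ∀ a, h.eval a = eval (fun i => i.elim (-b) fun i => i.elim (-a) y) D := by
    intro a
    rw [Polynomial.eval_mvPolynomial_aeval]
    congr 2
    funext i
    rcases i with _ | _ | i <;> simp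
  have h0 : h = 0 := by
    by_contra h0
    refine hb ((Polynomial.finite_setOfPred_isRoot h0).subset fun a ha => ?_)
    exact (hh a).trans ha
  have := hh (-P (some none))
  rw [h0, Polynomial.eval_zero, neg_neg] at this
  exact (hg b).trans this.symm

theorem subsingleton_setOf_pow_eq_div {k K : Type*} [Field k] [IsAlgClosed k] [Field K]
    [Algebra k K] {p : ℕ} [Fact p.Prime] [CharP K p] {t₁ t₂ : K} (ht₂ : ¬ ∃ y : K, y ^ p = t₂)
    (b : k) : {a : k | ∃ z : K, z ^ p = (t₁ + algebraMap k K a) /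
      (t₂ + algebraMap k K b)}.Subsingleton := by
  have hk : ∀ c : k, algebraMap k K c ∈ (frobenius K p).fieldRange := by
    intro c
    obtain ⟨e, he⟩ := IsAlgClosed.exists_pow_nat_eq c (Fact.out : p.Prime).pos
    exact ⟨algebraMap k K e, by rw [frobenius_def, ← map_pow, he]⟩
  have ht₂' : t₂ ∉ (frobenius K p).fieldRange := ht₂
  rintro a ⟨z, hz⟩ a' ⟨z', hz'⟩
  have hmem : ∀ {x y : K}, y ^ p = x → x ∈ (frobenius K p).fieldRange := fun h => ⟨_, h⟩
  by_contra hne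
  apply ht₂'
  have hS : t₂ + algebraMap k K b ∈ (frobenius K p).fieldRange := by
    have h1 := div_mem (hk (a - a')) (sub_mem (hmem hz) (hmem hz'))
    have h2 : algebraMap k K (a - a') ≠ 0 := by
      rwa [Ne, map_eq_zero, sub_eq_zero]
    rwa [← sub_div, add_sub_add_left_eq_sub, ← map_sub, div_div_cancel₀ h2] at h1
  simpa using sub_mem hS (hk b)

theorem finite_setOf_not_isVeryGeneral {k : Type u} {K : Type v} {σ : Type v} [Field k] [Field K]
    [Algebra k K] [IsAlgClosed k] [Algebra (MvPolynomial (Option (Option σ)) k) K]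
    [IsScalarTower k (MvPolynomial (Option (Option σ)) k) K] {ℓ : ℕ} (hℓ : ℓ.Prime)
    (hchar : ringChar k ≠ ℓ) (hK : IsFunctionField k K)
    (hz : IsTranscendenceBasis k fun i =>
      algebraMap (MvPolynomial (Option (Option σ)) k) K (X i))
    {d : ℕ} (hd : HasTrdeg k K d) {t₁ t₂ : K}
    (ht₁ : t₁ = algebraMap (MvPolynomial (Option (Option σ)) k) K (X (some none)))
    (ht₂ : t₂ = algebraMap (MvPolynomial (Option (Option σ)) k) K (X none))
    (hsep : IsSeparableIn K t₂) :
    {b : k | ¬ {a : k | ¬ IsVeryGeneral ℓ k d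
      ((t₁ + algebraMap k K a) / (t₂ + algebraMap k K b))}.Finite}.Finite := by
  obtain ⟨ε⟩ := hz.exists_equiv_of_option hd
  obtain ⟨p, hp⟩ := ExpChar.exists k
  obtain ⟨n, Φ, D, hΦ, hdeg, hD, hlift⟩ := exists_hasLaurentLifts.{max u v} hK hz p
  obtain ⟨y, hy⟩ := exists_finite_zeros_of_plane hD
  have hℓp : ¬ ℓ ∣ p ^ n := by
    intro h
    replace h := hℓ.dvd_of_dvd_pow h
    cases hp with
    | zero => exact hℓ.one_lt.ne' (Nat.dvd_one.1 h)
    | prime hp =>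
      rw [Nat.prime_dvd_prime_iff_eq hℓ hp] at h
      exact hchar (h ▸ ringChar.eq k p)
  refine hy.subset fun b hb hfin => hb ?_
  have hpow : {a : k | p ≠ 1 ∧ ∃ x : K, x ^ p =
      (t₁ + algebraMap k K a) / (t₂ + algebraMap k K b)}.Finite := by
    cases hp with
    | zero => simp
    | prime hp =>
      have : Fact p.Prime := ⟨hp⟩
      have : CharP K p := charP_of_injective_algebraMap (algebraMap k K).injective p
      exact (subsingleton_setOf_pow_eq_div (hsep p hp this) b).finite.subset fun a ha => ha.2
  refine (hfin.union hpow).subset fun a ha => ?_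
  by_contra hab
  refine ha (hlift.isVeryGeneral hℓ hd ε (pow_ne_zero n (expChar_pos k p).ne') hℓp hΦ hdeg _ _
    ht₁ ht₂ a b y (fun h => hab (Or.inl h)) ?_)
  exact hlift.isGeneralElement hΦ hdeg ht₁ ht₂ a b y
    (fun h => hab (Or.inl h)) fun hp x hx => hab (Or.inr ⟨hp, x, hx⟩)

end Assembly

theorem statement_15 (ℓ : ℕ) (hℓ : ℓ.Prime) (k K : Type*) [Field k] [Field K] [Algebra k K]
    [IsAlgClosed k] (hchar : ringChar k ≠ ℓ) (hK : IsFunctionField k K)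
    (d : ℕ) (hd : HasTrdeg k K d) (h5 : 5 ≤ d)
    (t₁ t₂ : K) (hind : AlgebraicIndependent k ![t₁, t₂]) (hsep : IsSeparableIn K t₂) :
    {b : k | ¬ {a : k |
        ¬ IsVeryGeneral ℓ k d ((t₁ + algebraMap k K a) / (t₂ + algebraMap k K b))}.Finite}.Finite := by
  obtain ⟨σ, z, hz, h₁, h₂⟩ := exists_isTranscendenceBasis_option hind
  let _ : Algebra (MvPolynomial (Option (Option σ)) k) K :=
    (MvPolynomial.aeval z : MvPolynomial (Option (Option σ)) k →ₐ[k] K).toRingHom.toAlgebra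
  have hzX : ∀ i, algebraMap (MvPolynomial (Option (Option σ)) k) K (MvPolynomial.X i) = z i :=
    fun i => MvPolynomial.aeval_X z i
  have : IsScalarTower k (MvPolynomial (Option (Option σ)) k) K :=
    IsScalarTower.of_algebraMap_eq fun c =>
      ((MvPolynomial.aeval z : MvPolynomial (Option (Option σ)) k →ₐ[k] K).commutes c).symm
  exact finite_setOf_not_isVeryGeneral (σ := σ) hℓ hchar hK (by simpa only [hzX] using hz) hd
    (h₁.symm.trans (hzX _).symm) (h₂.symm.trans (hzX _).symm) hsep

end
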